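/- A discrete memoryless two-level security wiretap channel p(y,z1,z2|x) (satisfying X → Z1 → Z2) is embeddable if there exists a pair of auxiliary random variables U and V satisfying the Markov chain U → V → X → (Y,Z1,Z2) such that I(U;Y) ≥ I(U;Z2), the marginal p(v,x) is an optimal solution to the maximization program max_{p(v,x)} [I(V;Y) − I(V;Z2)], and I(V;Y|U) − I(V;Z1|U) > 0. -/

import Mathlib

open scoped BigOperators
noncomputable section

/-- A probability mass function on a finite type. -/
def IsPMF {α : Type*} [Fintype α] (p : α → ℝ) : Prop :=
  (∀ a, 0 ≤ p a) ∧ ∑ a, p a = 1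

/-- A discrete channel from `α` to `β`: every input determines a pmf on outputs. -/
def IsChannel {α β : Type*} [Fintype β] (W : α → β → ℝ) : Prop :=
  ∀ a, IsPMF (W a)

/-- Mutual information (in bits) of a joint pmf on `α × β`. -/
def mutInfo {α β : Type*} [Fintype α] [Fintype β] (p : α × β → ℝ) : ℝ :=
  ∑ ab : α × β,
    p ab * Real.logb 2 (p ab / ((∑ b, p (ab.1, b)) * (∑ a, p (a, ab.2))))

variable {𝒳 𝒴 𝒵₁ 𝒵₂ : Type} [Fintype 𝒳] [Fintype 𝒴] [Fintype 𝒵₁] [Fintype 𝒵₂]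

/-- The Markov chain `X → Z₁ → Z₂` for the channel `W : 𝒳 → 𝒴 × 𝒵₁ × 𝒵₂`:
the eavesdropper output `Z₂` is degraded with respect to `Z₁`. -/
def DegradedZ1Z2 (W : 𝒳 → 𝒴 × 𝒵₁ × 𝒵₂ → ℝ) : Prop :=
  ∃ q : 𝒵₁ → 𝒵₂ → ℝ, IsChannel q ∧
    ∀ x z₁ z₂, (∑ y, W x (y, z₁, z₂)) = (∑ y, ∑ z₂', W x (y, z₁, z₂')) * q z₁ z₂

/-- Joint pmf of messages, inputs and outputs induced by a (possibly stochastic) encoder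
`enc` used on the memoryless channel `W` with uniform independent messages. -/
def codeJoint {n K₁ K₂ : ℕ} (W : 𝒳 → 𝒴 × 𝒵₁ × 𝒵₂ → ℝ)
    (enc : Fin K₁ × Fin K₂ → (Fin n → 𝒳) → ℝ)
    (m : Fin K₁ × Fin K₂) (xs : Fin n → 𝒳) (ys : Fin n → 𝒴)
    (z1s : Fin n → 𝒵₁) (z2s : Fin n → 𝒵₂) : ℝ :=
  ((K₁ : ℝ) * (K₂ : ℝ))⁻¹ * enc m xs * ∏ i, W (xs i) (ys i, z1s i, z2s i)

/-- Average probability of a decoding error at the legitimate receiver. -/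
def errProb {n K₁ K₂ : ℕ} (W : 𝒳 → 𝒴 × 𝒵₁ × 𝒵₂ → ℝ)
    (enc : Fin K₁ × Fin K₂ → (Fin n → 𝒳) → ℝ)
    (dec : (Fin n → 𝒴) → Fin K₁ × Fin K₂) : ℝ :=
  ∑ m, ∑ xs, ∑ ys, ∑ z1s, ∑ z2s,
    if dec ys ≠ m then codeJoint W enc m xs ys z1s z2s else 0

/-- The information leakage `I(M₁,M₂; Z₂ⁿ)` to the weak eavesdropper realization. -/
def leakMZ2 {n K₁ K₂ : ℕ} (W : 𝒳 → 𝒴 × 𝒵₁ × 𝒵₂ → ℝ)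
    (enc : Fin K₁ × Fin K₂ → (Fin n → 𝒳) → ℝ) : ℝ :=
  mutInfo (fun q : (Fin K₁ × Fin K₂) × (Fin n → 𝒵₂) =>
    ∑ xs, ∑ ys, ∑ z1s, codeJoint W enc q.1 xs ys z1s q.2)

/-- The information leakage `I(M₁; Z₁ⁿ)` to the strong eavesdropper realization. -/
def leakM1Z1 {n K₁ K₂ : ℕ} (W : 𝒳 → 𝒴 × 𝒵₁ × 𝒵₂ → ℝ)
    (enc : Fin K₁ × Fin K₂ → (Fin n → 𝒳) → ℝ) : ℝ :=
  mutInfo (fun q : Fin K₁ × (Fin n → 𝒵₁) =>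
    ∑ m₂, ∑ xs, ∑ ys, ∑ z2s, codeJoint W enc (q.1, m₂) xs ys q.2 z2s)

/-- A rate pair `(R₁,R₂)` is achievable for the two-level security wiretap channel `W`:
there are codes of blocklength `n` whose rates are arbitrarily close to `(R₁,R₂)`, with
vanishing error probability at the legitimate receiver, vanishing normalized leakage
`(1/n) I(M₁,M₂;Z₂ⁿ)` of both messages to the weak eavesdropper realization, and vanishing
normalized leakage `(1/n) I(M₁;Z₁ⁿ)` of the high-security message to the strong one. -/
def Achievable (W : 𝒳 → 𝒴 × 𝒵₁ × 𝒵₂ → ℝ) (R₁ R₂ : ℝ) : Prop :=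
  ∀ ε > 0, ∃ n : ℕ, 0 < n ∧ ∃ K₁ K₂ : ℕ, 0 < K₁ ∧ 0 < K₂ ∧
    (n : ℝ) * (R₁ - ε) ≤ Real.logb 2 K₁ ∧ (n : ℝ) * (R₂ - ε) ≤ Real.logb 2 K₂ ∧
    ∃ enc : Fin K₁ × Fin K₂ → (Fin n → 𝒳) → ℝ, IsChannel enc ∧
      ∃ dec : (Fin n → 𝒴) → Fin K₁ × Fin K₂,
        errProb W enc dec ≤ ε ∧
        leakMZ2 W enc ≤ (n : ℝ) * ε ∧
        leakM1Z1 W enc ≤ (n : ℝ) * ε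

/-- Conditional mutual information `I(A;B|C)` (in bits) of a joint pmf on `α × β × γ`,
where the conditioning variable is the third coordinate. -/
def condMutInfo {α β γ : Type*} [Fintype α] [Fintype β] [Fintype γ]
    (p : α × β × γ → ℝ) : ℝ :=
  ∑ x : α × β × γ,
    p x * Real.logb 2
      (((∑ a, ∑ b, p (a, b, x.2.2)) * p x) /
        ((∑ b, p (x.1, b, x.2.2)) * (∑ a, p (a, x.2.1, x.2.2))))

/-- Marginal channel to the legitimate receiver. -/
def WY (W : 𝒳 → 𝒴 × 𝒵₁ × 𝒵₂ → ℝ) (x : 𝒳) (y : 𝒴) : ℝ := ∑ z₁, ∑ z₂, W x (y, z₁, z₂)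

/-- Marginal channel to the strong eavesdropper realization. -/
def WZ1 (W : 𝒳 → 𝒴 × 𝒵₁ × 𝒵₂ → ℝ) (x : 𝒳) (z₁ : 𝒵₁) : ℝ := ∑ y, ∑ z₂, W x (y, z₁, z₂)

/-- Marginal channel to the weak eavesdropper realization. -/
def WZ2 (W : 𝒳 → 𝒴 × 𝒵₁ × 𝒵₂ → ℝ) (x : 𝒳) (z₂ : 𝒵₂) : ℝ := ∑ y, ∑ z₁, W x (y, z₁, z₂)
/-- The secrecy capacity `max_{p(v,x)} [I(V;Y) − I(V;Z₂)]` of the wiretap channel to the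
weak eavesdropper realization, the supremum being over all joint distributions of the
input with an auxiliary random variable `V` on a finite alphabet. -/
def wiretapCapZ2 (W : 𝒳 → 𝒴 × 𝒵₁ × 𝒵₂ → ℝ) : ℝ :=
  sSup {r : ℝ | ∃ (k : ℕ) (p : Fin k × 𝒳 → ℝ), IsPMF p ∧
    r = mutInfo (fun q : Fin k × 𝒴 => ∑ x, p (q.1, x) * WY W x q.2) -
        mutInfo (fun q : Fin k × 𝒵₂ => ∑ x, p (q.1, x) * WZ2 W x q.2)}

/-- A two-level security wiretap channel is embeddable if some achievable rate pair has
`R₁ > 0` and sum rate equal to the secrecy capacity of the wiretap channel `p(y,z₂|x)`. -/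
def Embeddable (W : 𝒳 → 𝒴 × 𝒵₁ × 𝒵₂ → ℝ) : Prop :=
  ∃ R₁ R₂ : ℝ, 0 < R₁ ∧ 0 ≤ R₂ ∧ Achievable W R₁ R₂ ∧ R₁ + R₂ = wiretapCapZ2 W



lemma aux_gibbs {ι : Type*} [Fintype ι] (p q : ι → ℝ) (hp : ∀ i, 0 ≤ p i) (hq : ∀ i, 0 ≤ q i)
    (hpq : ∀ i, q i = 0 → p i = 0) :
    ∑ i, p i - ∑ i, q i ≤ ∑ i, p i * Real.log (p i / q i) := by
  rw [← Finset.sum_sub_distrib]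
  refine Finset.sum_le_sum fun i _ => ?_
  rcases (hp i).eq_or_lt with h | h
  · rw [← h]; simp [hq i]
  · have hq' : 0 < q i := (hq i).lt_of_ne fun h0 => h.ne' (hpq i h0.symm)
    have h1 : Real.log (q i / p i) ≤ q i / p i - 1 := Real.log_le_sub_one_of_pos (by positivity)
    have h2 : Real.log (p i / q i) = - Real.log (q i / p i) := by
      rw [← Real.log_inv, inv_div]
    rw [h2]
    have h3 : p i * Real.log (q i / p i) ≤ p i * (q i / p i - 1) := by gcongr
    have h4 : p i * (q i / p i - 1) = q i - p i := by field_simp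
    linarith

lemma aux_logsum {ι : Type*} [Fintype ι] (p q : ι → ℝ) (hp : ∀ i, 0 ≤ p i) (hq : ∀ i, 0 ≤ q i)
    (hpq : ∀ i, q i = 0 → p i = 0) :
    (∑ i, p i) * Real.log ((∑ i, p i) / ∑ i, q i) ≤ ∑ i, p i * Real.log (p i / q i) := by
  rcases (Finset.sum_nonneg fun i (_ : i ∈ Finset.univ) => hp i).eq_or_lt with h | h
  · have h0 : ∀ i, p i = 0 := by
      intro i
      have := (Finset.sum_eq_zero_iff_of_nonneg (fun i (_ : i ∈ Finset.univ) => hp i)).1 h.symm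
      exact this i (Finset.mem_univ i)
    simp [h0]
  · have hQ : 0 < ∑ i, q i := by
      refine (Finset.sum_nonneg fun i _ => hq i).lt_of_ne fun h0 => ?_
      have h1 := (Finset.sum_eq_zero_iff_of_nonneg
        (fun i (_ : i ∈ Finset.univ) => hq i)).1 h0.symm
      have : ∑ i, p i = 0 := Finset.sum_eq_zero fun i hi => hpq i (h1 i hi)
      exact h.ne' this
    set P := ∑ i, p i with hP
    set Q := ∑ i, q i with hQd
    have hc : 0 < P / Q := by positivity
    have hg := aux_gibbs p (fun i => q i * (P / Q)) hp (fun i => mul_nonneg (hq i) hc.le)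
      (fun i hi => hpq i (by
        rcases mul_eq_zero.1 hi with h | h
        · exact h
        · exact absurd h hc.ne'))
    rw [← Finset.sum_mul, ← hQd, ← hP] at hg
    have e1 : P - Q * (P / Q) = 0 := by field_simp; ring
    rw [e1] at hg
    have e2 : ∀ i, p i * Real.log (p i / (q i * (P / Q)))
        = p i * Real.log (p i / q i) - p i * Real.log (P / Q) := by
      intro i
      rcases (hp i).eq_or_lt with h | h
      · simp [← h]
      · have hq' : 0 < q i := (hq i).lt_of_ne fun h0 => h.ne' (hpq i h0.symm)
        rw [← div_div, Real.log_div (by positivity) hc.ne']; ring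
    simp_rw [e2] at hg
    rw [Finset.sum_sub_distrib, ← Finset.sum_mul, ← hP] at hg
    linarith

lemma aux_tangent {x t : ℝ} (hx : 0 < x) (ht : 0 < t) :
    Real.log x ≤ Real.log t + x / t - 1 := by
  have h1 : Real.log (x / t) ≤ x / t - 1 := Real.log_le_sub_one_of_pos (by positivity)
  rw [Real.log_div hx.ne' ht.ne'] at h1
  linarith

/-! ### expectations under product pmfs -/

lemma aux_pi_sum {A S : Type*} [Fintype A] [Fintype S] [DecidableEq A] (F : A → S → ℝ) :
    ∑ c : A → S, ∏ a, F a (c a) = ∏ a, ∑ s, F a s := by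
  rw [Finset.prod_univ_sum, Fintype.piFinset_univ]

lemma aux_pi_total {A S : Type*} [Fintype A] [Fintype S] [DecidableEq A] (q : S → ℝ)
    (hq : ∑ s, q s = 1) : ∑ c : A → S, ∏ a, q (c a) = 1 := by
  rw [aux_pi_sum (fun _ => q)]; simp [hq]

lemma aux_pi_exp1 {A S : Type*} [Fintype A] [Fintype S] [DecidableEq A] (q : S → ℝ)
    (hq : ∑ s, q s = 1) (a0 : A) (g : S → ℝ) :
    ∑ c : A → S, (∏ a, q (c a)) * g (c a0) = ∑ s, q s * g s := by
  have h := aux_pi_sum (fun (a : A) (s : S) => q s * (if a = a0 then g s else 1))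
  have h2 : ∀ c : A → S, ∏ a, q (c a) * (if a = a0 then g (c a) else 1)
      = (∏ a, q (c a)) * g (c a0) := by
    intro c
    rw [Finset.prod_mul_distrib]
    simp
  simp_rw [h2] at h
  rw [h, Finset.prod_eq_single a0]
  · simp
  · intro a _ ha; simp [ha, hq]
  · simp

lemma aux_pi_exp2 {A S : Type*} [Fintype A] [Fintype S] [DecidableEq A] (q : S → ℝ)
    (hq : ∑ s, q s = 1) (a0 a1 : A) (hne : a0 ≠ a1) (g h : S → ℝ) :
    ∑ c : A → S, (∏ a, q (c a)) * (g (c a0) * h (c a1))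
      = (∑ s, q s * g s) * ∑ s, q s * h s := by
  have hh := aux_pi_sum (fun (a : A) (s : S) =>
    q s * ((if a = a0 then g s else 1) * (if a = a1 then h s else 1)))
  have h2 : ∀ c : A → S, ∏ a, q (c a) * ((if a = a0 then g (c a) else 1) *
      (if a = a1 then h (c a) else 1))
      = (∏ a, q (c a)) * (g (c a0) * h (c a1)) := by
    intro c
    rw [Finset.prod_mul_distrib, Finset.prod_mul_distrib]
    simp
  simp_rw [h2] at hh
  rw [hh, ← Finset.prod_subset (Finset.subset_univ {a0, a1})]
  · rw [Finset.prod_pair hne]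
    simp [hne, hne.symm]
  · intro a _ ha
    simp only [Finset.mem_insert, Finset.mem_singleton, not_or] at ha
    simp [ha.1, ha.2, hq]

/-- second moment bound -/
lemma aux_moment {α : Type*} [Fintype α] (p : α → ℝ) (hp : ∀ a, 0 ≤ p a) (hs : ∑ a, p a = 1)
    (f : α → ℝ) : ∃ C : ℝ, 0 ≤ C ∧ ∀ n : ℕ, 0 < n →
      ∑ x : Fin n → α, (∏ i, p (x i)) * |∑ i, f (x i) - n * ∑ a, p a * f a| ≤ C * √n := by
  set μ := ∑ a, p a * f a with hμ
  set σ := ∑ a, p a * (f a - μ) ^ 2 with hσ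
  have hσ0 : 0 ≤ σ := Finset.sum_nonneg fun a _ => mul_nonneg (hp a) (sq_nonneg _)
  refine ⟨(1 + σ) / 2, by positivity, fun n hn => ?_⟩
  have hn' : (0 : ℝ) < √n := Real.sqrt_pos.2 (by exact_mod_cast hn)
  have hsq : √(n : ℝ) * √n = n := Real.mul_self_sqrt (by positivity)
  have hg0 : ∑ a, p a * (f a - μ) = 0 := by
    simp_rw [mul_sub]
    rw [Finset.sum_sub_distrib, ← Finset.sum_mul, hs, ← hμ]; ring
  have hX : ∀ x : Fin n → α, ∑ i, f (x i) - n * μ = ∑ i, (f (x i) - μ) := by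
    intro x; rw [Finset.sum_sub_distrib]; simp
  have hE : ∑ x : Fin n → α, (∏ i, p (x i)) * (∑ i, (f (x i) - μ)) ^ 2 = n * σ := by
    have : ∀ x : Fin n → α, (∏ i, p (x i)) * (∑ i, (f (x i) - μ)) ^ 2
        = ∑ i, ∑ j, (∏ i, p (x i)) * ((f (x i) - μ) * (f (x j) - μ)) := by
      intro x
      rw [sq, Finset.sum_mul_sum, Finset.mul_sum]
      simp_rw [Finset.mul_sum]
    simp_rw [this]
    rw [Finset.sum_comm]
    have h3 : ∀ i : Fin n, ∑ x : Fin n → α, ∑ j, (∏ i, p (x i)) *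
        ((f (x i) - μ) * (f (x j) - μ)) = σ := by
      intro i
      rw [Finset.sum_comm, Finset.sum_eq_single i]
      · have := aux_pi_exp1 p hs i (fun a => (f a - μ) * (f a - μ))
        rw [this, hσ]
        simp_rw [sq]
      · intro j _ hj
        have := aux_pi_exp2 p hs i j hj.symm (fun a => (f a - μ)) (fun a => (f a - μ))
        rw [this, hg0]; ring
      · simp
    simp_rw [h3]; simp
  have hle : ∀ x : Fin n → α, (∏ i, p (x i)) * |∑ i, f (x i) - n * μ|
      ≤ (∏ i, p (x i)) * (√n / 2) + (∏ i, p (x i)) * (∑ i, (f (x i) - μ)) ^ 2 * (1 / (2 * √n)) := by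
    intro x
    rw [hX x, mul_assoc, ← mul_add]
    refine mul_le_mul_of_nonneg_left ?_ (Finset.prod_nonneg fun i _ => hp _)
    set X := ∑ i, (f (x i) - μ)
    rw [← sq_abs X]
    have : √n / 2 + |X| ^ 2 * (1 / (2 * √n)) - |X| = (√n - |X|) ^ 2 / (2 * √n) := by
      field_simp; ring
    have h5 : 0 ≤ (√n - |X|) ^ 2 / (2 * √n) := by positivity
    linarith
  refine (Finset.sum_le_sum fun x _ => hle x).trans ?_
  rw [Finset.sum_add_distrib, ← Finset.sum_mul, ← Finset.sum_mul, hE, aux_pi_total p hs]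
  have : (n : ℝ) * σ * (1 / (2 * √n)) = σ / 2 * √n := by
    rw [show (n : ℝ) * σ * (1 / (2 * √n)) = (√n * √n) * σ * (1 / (2 * √n)) by rw [hsq]]
    field_simp
  rw [this]; apply le_of_eq; ring


/-- Random superposition codebook: what is needed about its low-order marginals. -/
structure AuxEns {Ω A B U V : Type} [Fintype Ω] [Fintype U] [Fintype V]
    (w : Ω → ℝ) (cu : Ω → A → U) (cv : Ω → A → B → V) (pU : U → ℝ) (k : U → V → ℝ) : Prop where
  nonneg : ∀ o, 0 ≤ w o
  total : ∑ o, w o = 1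
  supp : ∀ o, w o ≠ 0 → ∀ a b, pU (cu o a) ≠ 0 ∧ k (cu o a) (cv o a b) ≠ 0
  one : ∀ a b (F : U → V → ℝ), ∑ o, w o * F (cu o a) (cv o a b) = ∑ u, ∑ v, pU u * k u v * F u v
  ind : ∀ a a' b b', a ≠ a' → ∀ F G : U → V → ℝ,
    ∑ o, w o * (F (cu o a) (cv o a b) * G (cu o a') (cv o a' b'))
      = (∑ u, ∑ v, pU u * k u v * F u v) * (∑ u, ∑ v, pU u * k u v * G u v)
  sat : ∀ a b b', b ≠ b' → ∀ F G : U → V → ℝ,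
    ∑ o, w o * (F (cu o a) (cv o a b) * G (cu o a) (cv o a b'))
      = ∑ u, pU u * ((∑ v, k u v * F u v) * ∑ v, k u v * G u v)

lemma AuxEns.comap {Ω A B U V A' B' : Type} [Fintype Ω] [Fintype U] [Fintype V]
    {w : Ω → ℝ} {cu : Ω → A → U} {cv : Ω → A → B → V} {pU : U → ℝ} {k : U → V → ℝ}
    (h : AuxEns w cu cv pU k) (φ : A' → A) (hφ : Function.Injective φ)
    (ψ : B' → B) (hψ : Function.Injective ψ) :
    AuxEns w (fun o a => cu o (φ a)) (fun o a b => cv o (φ a) (ψ b)) pU k where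
  nonneg := h.nonneg
  total := h.total
  supp := fun o ho a b => h.supp o ho _ _
  one := fun a b F => h.one _ _ F
  ind := fun a a' b b' hne F G => h.ind _ _ _ _ (hφ.ne hne) F G
  sat := fun a b b' hne F G => h.sat _ _ _ (hψ.ne hne) F G

lemma aux_ens_exists (A B : Type) {U V : Type} [Fintype A] [Fintype B] [Fintype U] [Fintype V]
    (pU : U → ℝ) (k : U → V → ℝ) (hpU : ∀ u, 0 ≤ pU u) (hpU1 : ∑ u, pU u = 1)
    (hk : ∀ u v, 0 ≤ k u v) (hk1 : ∀ u, ∑ v, k u v = 1) :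
    ∃ (Ω : Type) (_ : Fintype Ω) (w : Ω → ℝ) (cu : Ω → A → U) (cv : Ω → A → B → V),
      AuxEns w cu cv pU k := by
  classical
  let q : U × (B → V) → ℝ := fun s => pU s.1 * ∏ b, k s.1 (s.2 b)
  have hq1 : ∑ s, q s = 1 := by
    rw [Fintype.sum_prod_type]
    simp only [q]
    simp_rw [← Finset.mul_sum, aux_pi_total _ (hk1 _), mul_one, hpU1]
  have hone : ∀ b (F : U → V → ℝ), ∑ s : U × (B → V), q s * F s.1 (s.2 b)
      = ∑ u, ∑ v, pU u * k u v * F u v := by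
    intro b F
    rw [Fintype.sum_prod_type]
    refine Finset.sum_congr rfl fun u _ => ?_
    simp only [q]
    simp_rw [mul_assoc, ← Finset.mul_sum]
    rw [aux_pi_exp1 (k u) (hk1 u) b (F u)]
  refine ⟨A → U × (B → V), inferInstance, fun c => ∏ a, q (c a), fun c a => (c a).1,
    fun c a b => (c a).2 b, ?_, ?_, ?_, ?_, ?_, ?_⟩
  · exact fun c => Finset.prod_nonneg fun a _ =>
      mul_nonneg (hpU _) (Finset.prod_nonneg fun b _ => hk _ _)
  · exact aux_pi_total q hq1
  · intro c hc a b
    have h1 := Finset.prod_ne_zero_iff.1 hc a (Finset.mem_univ a)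
    have h2 := mul_ne_zero_iff.1 h1
    exact ⟨h2.1, Finset.prod_ne_zero_iff.1 h2.2 b (Finset.mem_univ b)⟩
  · intro a b F
    rw [aux_pi_exp1 q hq1 a (fun s => F s.1 (s.2 b)), hone]
  · intro a a' b b' hne F G
    rw [aux_pi_exp2 q hq1 a a' hne (fun s => F s.1 (s.2 b)) (fun s => G s.1 (s.2 b')),
      hone, hone]
  · intro a b b' hne F G
    rw [aux_pi_exp1 q hq1 a (fun s => F s.1 (s.2 b) * G s.1 (s.2 b')), Fintype.sum_prod_type]
    refine Finset.sum_congr rfl fun u _ => ?_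
    simp only [q]
    simp_rw [mul_assoc, ← Finset.mul_sum]
    rw [aux_pi_exp2 (k u) (hk1 u) b b' hne (F u) (G u)]

/-- expectation over the triple `(u,v,z)` -/
def auxE3 {U V Z : Type} [Fintype U] [Fintype V] [Fintype Z] (pU : U → ℝ) (k : U → V → ℝ)
    (T : V → Z → ℝ) (F : U → V → Z → ℝ) : ℝ :=
  ∑ u, ∑ v, ∑ z, pU u * k u v * T v z * F u v z

/-- output law given `u` -/
def auxPU {U V Z : Type} [Fintype V] (k : U → V → ℝ) (T : V → Z → ℝ) (u : U) (z : Z) : ℝ :=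
  ∑ v, k u v * T v z

/-- output law -/
def auxP {U V Z : Type} [Fintype U] [Fintype V] (pU : U → ℝ) (k : U → V → ℝ)
    (T : V → Z → ℝ) (z : Z) : ℝ :=
  ∑ u, pU u * auxPU k T u z

/-- Bundled hypotheses. -/
structure AuxSrc {U V Z : Type} [Fintype U] [Fintype V] [Fintype Z]
    (pU : U → ℝ) (k : U → V → ℝ) (T : V → Z → ℝ) : Prop where
  pU0 : ∀ u, 0 ≤ pU u
  pU1 : ∑ u, pU u = 1
  k0 : ∀ u v, 0 ≤ k u v
  k1 : ∀ u, ∑ v, k u v = 1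
  T0 : ∀ v z, 0 ≤ T v z
  T1 : ∀ v, ∑ z, T v z = 1

section
variable {U V Z : Type} [Fintype U] [Fintype V] [Fintype Z]
    {pU : U → ℝ} {k : U → V → ℝ} {T : V → Z → ℝ}

lemma AuxSrc.PU0 (h : AuxSrc pU k T) (u : U) (z : Z) : 0 ≤ auxPU k T u z :=
  Finset.sum_nonneg fun v _ => mul_nonneg (h.k0 u v) (h.T0 v z)

lemma AuxSrc.P0 (h : AuxSrc pU k T) (z : Z) : 0 ≤ auxP pU k T z :=
  Finset.sum_nonneg fun u _ => mul_nonneg (h.pU0 u) (h.PU0 u z)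

lemma AuxSrc.PU1 (h : AuxSrc pU k T) (u : U) : ∑ z, auxPU k T u z = 1 := by
  unfold auxPU
  rw [Finset.sum_comm]
  simp_rw [← Finset.mul_sum, h.T1, mul_one, h.k1]

lemma AuxSrc.P1 (h : AuxSrc pU k T) : ∑ z, auxP pU k T z = 1 := by
  unfold auxP
  rw [Finset.sum_comm]
  simp_rw [← Finset.mul_sum, h.PU1, mul_one, h.pU1]

lemma AuxSrc.PU_pos (h : AuxSrc pU k T) {u : U} {v : V} {z : Z} (hk : k u v ≠ 0)
    (hT : T v z ≠ 0) : 0 < auxPU k T u z := by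
  refine lt_of_lt_of_le (mul_pos ((h.k0 u v).lt_of_ne' hk) ((h.T0 v z).lt_of_ne' hT)) ?_
  exact Finset.single_le_sum (f := fun v => k u v * T v z)
    (fun v _ => mul_nonneg (h.k0 u v) (h.T0 v z)) (Finset.mem_univ v)

lemma AuxSrc.P_pos (h : AuxSrc pU k T) {u : U} {v : V} {z : Z} (hu : pU u ≠ 0) (hk : k u v ≠ 0)
    (hT : T v z ≠ 0) : 0 < auxP pU k T z := by
  refine lt_of_lt_of_le (mul_pos ((h.pU0 u).lt_of_ne' hu) (h.PU_pos hk hT)) ?_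
  exact Finset.single_le_sum (f := fun u => pU u * auxPU k T u z)
    (fun u _ => mul_nonneg (h.pU0 u) (h.PU0 u z)) (Finset.mem_univ u)

lemma AuxSrc.P_eq (pU : U → ℝ) (k : U → V → ℝ) (T : V → Z → ℝ) (z : Z) :
    ∑ u, ∑ v, pU u * k u v * T v z = auxP pU k T z := by
  unfold auxP auxPU
  simp_rw [Finset.mul_sum, mul_assoc]

lemma AuxSrc.E3_mono (h : AuxSrc pU k T) {F G : U → V → Z → ℝ}
    (hFG : ∀ u v z, pU u ≠ 0 → k u v ≠ 0 → T v z ≠ 0 → F u v z ≤ G u v z) :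
    auxE3 pU k T F ≤ auxE3 pU k T G := by
  unfold auxE3
  refine Finset.sum_le_sum fun u _ => Finset.sum_le_sum fun v _ => Finset.sum_le_sum fun z _ => ?_
  by_cases hu : pU u = 0
  · simp [hu]
  by_cases hk : k u v = 0
  · simp [hk]
  by_cases hT : T v z = 0
  · simp [hT]
  exact mul_le_mul_of_nonneg_left (hFG u v z hu hk hT)
    (mul_nonneg (mul_nonneg (h.pU0 u) (h.k0 u v)) (h.T0 v z))

lemma AuxSrc.E3_congr (h : AuxSrc pU k T) {F G : U → V → Z → ℝ}
    (hFG : ∀ u v z, pU u ≠ 0 → k u v ≠ 0 → T v z ≠ 0 → F u v z = G u v z) :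
    auxE3 pU k T F = auxE3 pU k T G :=
  le_antisymm (h.E3_mono fun u v z a b c => (hFG u v z a b c).le)
    (h.E3_mono fun u v z a b c => (hFG u v z a b c).ge)

lemma auxE3_add (F G : U → V → Z → ℝ) :
    auxE3 pU k T (fun u v z => F u v z + G u v z) = auxE3 pU k T F + auxE3 pU k T G := by
  unfold auxE3
  simp_rw [mul_add, Finset.sum_add_distrib]

lemma auxE3_mul (F : U → V → Z → ℝ) (r : ℝ) :
    auxE3 pU k T (fun u v z => F u v z * r) = auxE3 pU k T F * r := by
  unfold auxE3
  simp_rw [← mul_assoc, Finset.sum_mul]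

lemma AuxSrc.E3_const (h : AuxSrc pU k T) (r : ℝ) : auxE3 pU k T (fun _ _ _ => r) = r := by
  unfold auxE3
  simp_rw [← Finset.sum_mul, ← Finset.mul_sum, h.T1, mul_one, ← Finset.mul_sum, h.k1, mul_one,
    h.pU1, one_mul]

end


lemma aux_cover_core {Ω J Z : Type} [Fintype Ω] [Fintype J] [Fintype Z] [Nonempty J]
    (w : Ω → ℝ) (hw : ∀ o, 0 ≤ w o) (g t : Ω → J → Z → ℝ) (Q : Ω → Z → ℝ)
    (hg : ∀ o j z, 0 ≤ g o j z) (ht : ∀ o j z, 0 < t o j z)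
    (hsupp : ∀ o, w o ≠ 0 → ∀ j z, g o j z ≠ 0 → 0 < Q o z)
    (hkey : ∀ j z, ∑ o, w o * (g o j z / (t o j z * Q o z) *
        ((Fintype.card J : ℝ)⁻¹ * ∑ j', g o j' z)) ≤ ∑ o, w o * g o j z) :
    ∑ o, w o * ∑ z, ((Fintype.card J : ℝ)⁻¹ * ∑ j, g o j z) *
        Real.log (((Fintype.card J : ℝ)⁻¹ * ∑ j, g o j z) / Q o z)
      ≤ (Fintype.card J : ℝ)⁻¹ * ∑ j, ∑ z, ∑ o, w o * (g o j z * Real.log (t o j z)) := by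
  set N : ℝ := (Fintype.card J : ℝ) with hN
  have hN0 : 0 < N := by rw [hN]; exact_mod_cast Fintype.card_pos
  set P : Ω → Z → ℝ := fun o z => N⁻¹ * ∑ j, g o j z with hP
  have hpt : ∀ o j z, w o * (g o j z * Real.log (P o z / Q o z)) ≤
      w o * (g o j z * Real.log (t o j z)) +
        (w o * (g o j z / (t o j z * Q o z) * P o z) - w o * g o j z) := by
    intro o j z
    by_cases hw0 : w o = 0
    · simp [hw0]
    by_cases hg0 : g o j z = 0
    · simp [hg0]
    have hQ := hsupp o hw0 j z hg0
    have hgp : 0 < g o j z := (hg o j z).lt_of_ne' hg0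
    have hPp : 0 < P o z := by
      refine mul_pos (inv_pos.2 hN0) (lt_of_lt_of_le hgp ?_)
      exact Finset.single_le_sum (f := fun j => g o j z) (fun j _ => hg o j z) (Finset.mem_univ j)
    have h1 := aux_tangent (div_pos hPp hQ) (ht o j z)
    have h2 := mul_le_mul_of_nonneg_left h1 (mul_nonneg (hw o) hgp.le)
    have htp := ht o j z
    calc _ = w o * g o j z * Real.log (P o z / Q o z) := by ring
      _ ≤ _ := h2
      _ = _ := by field_simp; ring
  calc ∑ o, w o * ∑ z, P o z * Real.log (P o z / Q o z)
      = N⁻¹ * ∑ j, ∑ z, ∑ o, w o * (g o j z * Real.log (P o z / Q o z)) := by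
        have : ∀ o, w o * ∑ z, P o z * Real.log (P o z / Q o z)
            = N⁻¹ * ∑ j, ∑ z, w o * (g o j z * Real.log (P o z / Q o z)) := by
          intro o
          rw [Finset.sum_comm, Finset.mul_sum, Finset.mul_sum]
          refine Finset.sum_congr rfl fun z _ => ?_
          rw [← Finset.mul_sum, ← Finset.sum_mul]
          simp only [hP]; ring
        simp_rw [this]
        rw [← Finset.mul_sum, Finset.sum_comm]
        congr 1
        refine Finset.sum_congr rfl fun j _ => ?_
        rw [Finset.sum_comm]
    _ ≤ N⁻¹ * ∑ j, ∑ z, ∑ o, w o * (g o j z * Real.log (t o j z)) := by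
        refine mul_le_mul_of_nonneg_left ?_ (inv_nonneg.2 hN0.le)
        refine Finset.sum_le_sum fun j _ => Finset.sum_le_sum fun z _ => ?_
        refine (Finset.sum_le_sum fun o _ => hpt o j z).trans ?_
        rw [Finset.sum_add_distrib, Finset.sum_sub_distrib]
        have := hkey j z
        linarith

lemma aux_log_le_posLog2 {x : ℝ} (hx : 0 ≤ x) : Real.log (1 + x) ≤ Real.log 2 + max 0 (Real.log x) := by
  rcases le_total x 1 with h | h
  · have : Real.log (1 + x) ≤ Real.log 2 := Real.log_le_log (by linarith) (by linarith)
    have := le_max_left 0 (Real.log x); linarith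
  · have : Real.log (1 + x) ≤ Real.log (2 * x) := Real.log_le_log (by linarith) (by linarith)
    rw [Real.log_mul (by norm_num) (by linarith)] at this
    have := le_max_right 0 (Real.log x); linarith

lemma aux_log_le_posLog3 {x y : ℝ} (hx : 0 ≤ x) (hy : 0 ≤ y) :
    Real.log (1 + x + y) ≤ Real.log 4 + max 0 (Real.log x) + max 0 (Real.log y) := by
  have h1 : Real.log (1 + x + y) ≤ Real.log ((1 + x) * (1 + y)) :=
    Real.log_le_log (by linarith) (by nlinarith [mul_nonneg hx hy])
  rw [Real.log_mul (by linarith) (by linarith)] at h1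
  have h4 : Real.log 4 = Real.log 2 + Real.log 2 := by
    rw [← Real.log_mul (by norm_num) (by norm_num)]; norm_num
  have := aux_log_le_posLog2 hx
  have := aux_log_le_posLog2 hy
  linarith

lemma aux_max_le {r N κ : ℝ} (hr : 0 ≤ r) (hN : 0 < N) (hκ : κ ≤ Real.log N) :
    max 0 (Real.log (r / N)) ≤ |Real.log r - κ| := by
  refine max_le (abs_nonneg _) ?_
  rcases hr.eq_or_lt with h | h
  · simp [← h]
  · rw [Real.log_div h.ne' hN.ne']
    exact le_trans (by linarith) (le_abs_self _)

section
variable {Ω A B U V Z : Type} [Fintype Ω] [Fintype A] [Fintype B] [Nonempty A] [Nonempty B]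
  [Fintype U] [Fintype V] [Fintype Z]
  {w : Ω → ℝ} {cu : Ω → A → U} {cv : Ω → A → B → V} {pU : U → ℝ} {k : U → V → ℝ}
  {T : V → Z → ℝ}

lemma AuxEns.sum_E3 (h : AuxEns w cu cv pU k) (a : A) (b : B) (F : U → V → Z → ℝ) :
    ∑ z, ∑ o, w o * (T (cv o a b) z * F (cu o a) (cv o a b) z) = auxE3 pU k T F := by
  have : ∀ z, ∑ o, w o * (T (cv o a b) z * F (cu o a) (cv o a b) z)
      = ∑ u, ∑ v, pU u * k u v * (T v z * F u v z) :=
    fun z => h.one a b (fun u v => T v z * F u v z)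
  simp_rw [this]
  unfold auxE3
  rw [Finset.sum_comm]
  refine Finset.sum_congr rfl fun u _ => ?_
  rw [Finset.sum_comm]
  simp_rw [mul_assoc]

/-- Superposition soft covering. -/
lemma AuxEns.cover2 (h : AuxEns w cu cv pU k) (hs : AuxSrc pU k T) (κ₁ κ₂ : ℝ)
    (h1 : κ₁ ≤ Real.log (Fintype.card A))
    (h2 : κ₂ ≤ Real.log ((Fintype.card A : ℝ) * Fintype.card B)) :
    ∑ o, w o * ∑ z, (((Fintype.card A : ℝ) * Fintype.card B)⁻¹ * ∑ a, ∑ b, T (cv o a b) z) *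
        Real.log ((((Fintype.card A : ℝ) * Fintype.card B)⁻¹ * ∑ a, ∑ b, T (cv o a b) z)
          / auxP pU k T z)
      ≤ Real.log 4 + auxE3 pU k T (fun u _ z => |Real.log (auxPU k T u z / auxP pU k T z) - κ₁|)
        + auxE3 pU k T (fun _ v z => |Real.log (T v z / auxP pU k T z) - κ₂|) := by
  classical
  set NA : ℝ := (Fintype.card A : ℝ) with hNA
  set NB : ℝ := (Fintype.card B : ℝ) with hNB
  have hA0 : 0 < NA := by rw [hNA]; exact_mod_cast Fintype.card_pos
  have hB0 : 0 < NB := by rw [hNB]; exact_mod_cast Fintype.card_pos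
  let tt : U → V → Z → ℝ := fun u v z =>
    1 + auxPU k T u z / auxP pU k T z / NA + T v z / auxP pU k T z / (NA * NB)
  have hx : ∀ u z, 0 ≤ auxPU k T u z / auxP pU k T z / NA := fun u z =>
    div_nonneg (div_nonneg (hs.PU0 u z) (hs.P0 z)) hA0.le
  have hy : ∀ v z, 0 ≤ T v z / auxP pU k T z / (NA * NB) := fun v z =>
    div_nonneg (div_nonneg (hs.T0 v z) (hs.P0 z)) (mul_pos hA0 hB0).le
  have htt : ∀ u v z, 0 < tt u v z := fun u v z => by
    have := hx u z; have := hy v z; simp only [tt]; linarith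
  have hcard : (Fintype.card (A × B) : ℝ) = NA * NB := by
    rw [Fintype.card_prod]; push_cast; rfl
  have core := aux_cover_core (J := A × B) w h.nonneg (fun o j z => T (cv o j.1 j.2) z)
    (fun o j z => tt (cu o j.1) (cv o j.1 j.2) z) (fun _ z => auxP pU k T z)
    (fun o j z => hs.T0 _ _) (fun o j z => htt _ _ _)
    (fun o ho j z hT => hs.P_pos (h.supp o ho j.1 j.2).1 (h.supp o ho j.1 j.2).2 hT)
    (by
      rintro ⟨a, b⟩ z
      rw [hcard]
      simp only
      set F : U → V → ℝ := fun u v => T v z / (tt u v z * auxP pU k T z) with hF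
      have hF0 : ∀ u v, 0 ≤ F u v := fun u v =>
        div_nonneg (hs.T0 _ _) (mul_nonneg (htt _ _ _).le (hs.P0 _))
      set G : U → V → ℝ := fun _ v => T v z with hG
      -- value of each pair
      set e1 := (∑ u, ∑ v, pU u * k u v * F u v) * auxP pU k T z with he1
      set e2 := ∑ u, ∑ v, pU u * k u v * (F u v * auxPU k T u z) with he2
      set e3 := ∑ u, ∑ v, pU u * k u v * (F u v * T v z) with he3
      have hpk : ∀ u v, 0 ≤ pU u * k u v := fun u v => mul_nonneg (hs.pU0 u) (hs.k0 u v)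
      have he1n : 0 ≤ e1 := mul_nonneg (Finset.sum_nonneg fun u _ => Finset.sum_nonneg fun v _ =>
        mul_nonneg (hpk u v) (hF0 u v)) (hs.P0 z)
      have he2n : 0 ≤ e2 := Finset.sum_nonneg fun u _ => Finset.sum_nonneg fun v _ =>
        mul_nonneg (hpk u v) (mul_nonneg (hF0 u v) (hs.PU0 u z))
      have he3n : 0 ≤ e3 := Finset.sum_nonneg fun u _ => Finset.sum_nonneg fun v _ =>
        mul_nonneg (hpk u v) (mul_nonneg (hF0 u v) (hs.T0 v z))
      have hpair : ∀ a' b', ∑ o, w o * (F (cu o a) (cv o a b) * T (cv o a' b') z)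
          ≤ e1 + (if a' = a then e2 else 0) + (if a' = a then (if b' = b then e3 else 0) else 0) := by
        intro a' b'
        by_cases ha : a' = a
        · subst ha
          by_cases hb : b' = b
          · subst hb
            have := h.one a' b' (fun u v => F u v * T v z)
            rw [this]
            simp only [if_true]
            linarith
          · have := h.sat a' b b' (Ne.symm hb) F G
            simp only [hG] at this
            rw [this]
            simp only [if_true, if_neg hb]
            have : ∑ u, pU u * ((∑ v, k u v * F u v) * ∑ v, k u v * T v z) = e2 := by
              refine Finset.sum_congr rfl fun u _ => ?_
              change pU u * ((∑ v, k u v * F u v) * auxPU k T u z) = _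
              rw [Finset.sum_mul, Finset.mul_sum]
              refine Finset.sum_congr rfl fun v _ => ?_
              ring
            rw [this]; linarith
        · have := h.ind a a' b b' (Ne.symm ha) F G
          simp only [hG] at this
          rw [this, AuxSrc.P_eq]
          simp only [if_neg ha]
          linarith
      have hexp : ∑ o, w o * (T (cv o a b) z / (tt (cu o a) (cv o a b) z * auxP pU k T z) *
          ((NA * NB)⁻¹ * ∑ j : A × B, T (cv o j.1 j.2) z))
          = (NA * NB)⁻¹ * ∑ a', ∑ b', ∑ o, w o * (F (cu o a) (cv o a b) * T (cv o a' b') z) := by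
        simp_rw [Fintype.sum_prod_type]
        have : ∀ o, w o * (T (cv o a b) z / (tt (cu o a) (cv o a b) z * auxP pU k T z) *
          ((NA * NB)⁻¹ * ∑ a', ∑ b', T (cv o a' b') z))
            = (NA * NB)⁻¹ * ∑ a', ∑ b', w o * (F (cu o a) (cv o a b) * T (cv o a' b') z) := by
          intro o
          simp_rw [← Finset.mul_sum]
          simp only [hF]; ring
        simp_rw [this]
        rw [← Finset.mul_sum, Finset.sum_comm]
        congr 1
        refine Finset.sum_congr rfl fun a' _ => ?_
        rw [Finset.sum_comm]
      have hsum : ∑ a', ∑ b', ∑ o, w o * (F (cu o a) (cv o a b) * T (cv o a' b') z)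
          ≤ NA * NB * e1 + NB * e2 + e3 := by
        refine (Finset.sum_le_sum fun a' _ => Finset.sum_le_sum fun b' _ => hpair a' b').trans ?_
        simp only [Finset.sum_add_distrib, Finset.sum_const, Finset.card_univ, nsmul_eq_mul,
          Finset.sum_ite_irrel, Finset.sum_ite_eq', Finset.mem_univ, if_true, mul_ite, mul_zero]
        rw [← hNA, ← hNB]
        simp [mul_assoc]
      have hone := h.one a b (fun _ v => T v z)
      rw [hexp, hone]
      calc (NA * NB)⁻¹ * ∑ a', ∑ b', ∑ o, w o * (F (cu o a) (cv o a b) * T (cv o a' b') z)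
          ≤ (NA * NB)⁻¹ * (NA * NB * e1 + NB * e2 + e3) := by gcongr
        _ = ∑ u, ∑ v, pU u * k u v * (F u v * (auxP pU k T z + auxPU k T u z / NA
              + T v z / (NA * NB))) := by
            have : (NA * NB)⁻¹ * (NA * NB * e1 + NB * e2 + e3)
              = e1 + e2 * (1 / NA) + e3 * (1 / (NA * NB)) := by field_simp
            rw [this, he1, he2, he3]
            simp_rw [Finset.sum_mul]
            rw [← Finset.sum_add_distrib, ← Finset.sum_add_distrib]
            refine Finset.sum_congr rfl fun u _ => ?_
            rw [← Finset.sum_add_distrib, ← Finset.sum_add_distrib]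
            refine Finset.sum_congr rfl fun v _ => ?_
            ring
        _ ≤ ∑ u, ∑ v, pU u * k u v * T v z := by
            refine Finset.sum_le_sum fun u _ => Finset.sum_le_sum fun v _ =>
              mul_le_mul_of_nonneg_left ?_ (hpk u v)
            rcases (hs.P0 z).eq_or_lt with h0 | h0
            · simp only [hF]; rw [← h0]; simp [hs.T0]
            · have ht := htt u v z
              have e : auxP pU k T z + auxPU k T u z / NA + T v z / (NA * NB)
                  = auxP pU k T z * tt u v z := by
                simp only [tt]; field_simp
              rw [e]; simp only [hF]
              apply le_of_eq
              field_simp)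
  rw [hcard] at core
  simp_rw [Fintype.sum_prod_type] at core
  refine core.trans ?_
  have hE : ∀ a b, ∑ z, ∑ o, w o * (T (cv o a b) z * Real.log (tt (cu o a) (cv o a b) z))
      = auxE3 pU k T (fun u v z => Real.log (tt u v z)) := fun a b =>
    h.sum_E3 a b (fun u v z => Real.log (tt u v z))
  simp_rw [hE]
  simp only [Finset.sum_const, Finset.card_univ, nsmul_eq_mul]
  rw [← hNA, ← hNB, ← mul_assoc, ← mul_assoc, mul_assoc _ NA NB, inv_mul_cancel₀ (by positivity),
    one_mul]
  rw [← hs.E3_const (Real.log 4), ← auxE3_add, ← auxE3_add]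
  refine hs.E3_mono fun u v z _ _ _ => ?_
  refine (aux_log_le_posLog3 (hx u z) (hy v z)).trans ?_
  have := aux_max_le (div_nonneg (hs.PU0 u z) (hs.P0 z)) hA0 h1
  have := aux_max_le (div_nonneg (hs.T0 v z) (hs.P0 z)) (mul_pos hA0 hB0) h2
  linarith

/-- Conditional soft covering inside one cloud. -/
lemma AuxEns.cover1 (h : AuxEns w cu cv pU k) (hs : AuxSrc pU k T) (κ : ℝ) (a : A)
    (h1 : κ ≤ Real.log (Fintype.card B)) :
    ∑ o, w o * ∑ z, ((Fintype.card B : ℝ)⁻¹ * ∑ b, T (cv o a b) z) *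
        Real.log (((Fintype.card B : ℝ)⁻¹ * ∑ b, T (cv o a b) z) / auxPU k T (cu o a) z)
      ≤ Real.log 2 + auxE3 pU k T (fun u v z => |Real.log (T v z / auxPU k T u z) - κ|) := by
  classical
  set NB : ℝ := (Fintype.card B : ℝ) with hNB
  have hB0 : 0 < NB := by rw [hNB]; exact_mod_cast Fintype.card_pos
  let tt : U → V → Z → ℝ := fun u v z => 1 + T v z / auxPU k T u z / NB
  have hy : ∀ u v z, 0 ≤ T v z / auxPU k T u z / NB := fun u v z =>
    div_nonneg (div_nonneg (hs.T0 v z) (hs.PU0 u z)) hB0.le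
  have htt : ∀ u v z, 0 < tt u v z := fun u v z => by
    have := hy u v z; simp only [tt]; linarith
  have core := aux_cover_core (J := B) w h.nonneg (fun o j z => T (cv o a j) z)
    (fun o j z => tt (cu o a) (cv o a j) z) (fun o z => auxPU k T (cu o a) z)
    (fun o j z => hs.T0 _ _) (fun o j z => htt _ _ _)
    (fun o ho j z hT => hs.PU_pos (h.supp o ho a j).2 hT)
    (by
      intro b z
      rw [← hNB]
      set F : U → V → ℝ := fun u v => T v z / (tt u v z * auxPU k T u z) with hF
      have hF0 : ∀ u v, 0 ≤ F u v := fun u v =>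
        div_nonneg (hs.T0 _ _) (mul_nonneg (htt _ _ _).le (hs.PU0 _ _))
      set G : U → V → ℝ := fun _ v => T v z with hG
      set e2 := ∑ u, ∑ v, pU u * k u v * (F u v * auxPU k T u z) with he2
      set e3 := ∑ u, ∑ v, pU u * k u v * (F u v * T v z) with he3
      have hpk : ∀ u v, 0 ≤ pU u * k u v := fun u v => mul_nonneg (hs.pU0 u) (hs.k0 u v)
      have he2n : 0 ≤ e2 := Finset.sum_nonneg fun u _ => Finset.sum_nonneg fun v _ =>
        mul_nonneg (hpk u v) (mul_nonneg (hF0 u v) (hs.PU0 u z))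
      have hpair : ∀ b', ∑ o, w o * (F (cu o a) (cv o a b) * T (cv o a b') z)
          ≤ e2 + (if b' = b then e3 else 0) := by
        intro b'
        by_cases hb : b' = b
        · subst hb
          have := h.one a b' (fun u v => F u v * T v z)
          rw [this]
          simp only [if_true]
          linarith
        · have := h.sat a b b' (Ne.symm hb) F G
          simp only [hG] at this
          rw [this]
          simp only [if_neg hb]
          have : ∑ u, pU u * ((∑ v, k u v * F u v) * ∑ v, k u v * T v z) = e2 := by
            refine Finset.sum_congr rfl fun u _ => ?_
            change pU u * ((∑ v, k u v * F u v) * auxPU k T u z) = _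
            rw [Finset.sum_mul, Finset.mul_sum]
            refine Finset.sum_congr rfl fun v _ => ?_
            ring
          rw [this]; linarith
      have hexp : ∑ o, w o * (T (cv o a b) z / (tt (cu o a) (cv o a b) z *
          auxPU k T (cu o a) z) * (NB⁻¹ * ∑ j, T (cv o a j) z))
          = NB⁻¹ * ∑ b', ∑ o, w o * (F (cu o a) (cv o a b) * T (cv o a b') z) := by
        rw [Finset.sum_comm, Finset.mul_sum]
        refine Finset.sum_congr rfl fun o _ => ?_
        simp_rw [← Finset.mul_sum]
        simp only [hF]; ring
      have hsum : ∑ b', ∑ o, w o * (F (cu o a) (cv o a b) * T (cv o a b') z)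
          ≤ NB * e2 + e3 := by
        refine (Finset.sum_le_sum fun b' _ => hpair b').trans ?_
        simp [Finset.sum_add_distrib, hNB]
      have hone := h.one a b (fun _ v => T v z)
      rw [hexp, hone]
      calc NB⁻¹ * ∑ b', ∑ o, w o * (F (cu o a) (cv o a b) * T (cv o a b') z)
          ≤ NB⁻¹ * (NB * e2 + e3) := by gcongr
        _ = ∑ u, ∑ v, pU u * k u v * (F u v * (auxPU k T u z + T v z / NB)) := by
            have : NB⁻¹ * (NB * e2 + e3) = e2 + e3 * (1 / NB) := by field_simp
            rw [this, he2, he3]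
            simp_rw [Finset.sum_mul]
            rw [← Finset.sum_add_distrib]
            refine Finset.sum_congr rfl fun u _ => ?_
            rw [← Finset.sum_add_distrib]
            refine Finset.sum_congr rfl fun v _ => ?_
            ring
        _ ≤ ∑ u, ∑ v, pU u * k u v * T v z := by
            refine Finset.sum_le_sum fun u _ => Finset.sum_le_sum fun v _ =>
              mul_le_mul_of_nonneg_left ?_ (hpk u v)
            rcases (hs.PU0 u z).eq_or_lt with h0 | h0
            · simp only [hF]; rw [← h0]; simp [hs.T0]
            · have ht := htt u v z
              have e : auxPU k T u z + T v z / NB = auxPU k T u z * tt u v z := by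
                simp only [tt]; field_simp
              rw [e]; simp only [hF]
              apply le_of_eq
              field_simp)
  refine core.trans ?_
  have hE : ∀ b, ∑ z, ∑ o, w o * (T (cv o a b) z * Real.log (tt (cu o a) (cv o a b) z))
      = auxE3 pU k T (fun u v z => Real.log (tt u v z)) := fun b =>
    h.sum_E3 a b (fun u v z => Real.log (tt u v z))
  simp_rw [hE]
  simp only [Finset.sum_const, Finset.card_univ, nsmul_eq_mul]
  rw [← hNB, ← mul_assoc, inv_mul_cancel₀ (by positivity), one_mul]
  rw [← hs.E3_const (Real.log 2), ← auxE3_add]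
  refine hs.E3_mono fun u v z _ _ _ => ?_
  refine (aux_log_le_posLog2 (hy u v z)).trans ?_
  have := aux_max_le (div_nonneg (hs.T0 v z) (hs.PU0 u z)) hB0 h1
  linarith

end


lemma aux_sum_comm4 {A B C D : Type} [Fintype A] [Fintype B] [Fintype C] [Fintype D]
    (f : A → B → C → D → ℝ) :
    ∑ a, ∑ b, ∑ c, ∑ d, f a b c d = ∑ c, ∑ d, ∑ a, ∑ b, f a b c d := by
  calc ∑ a, ∑ b, ∑ c, ∑ d, f a b c d = ∑ a, ∑ c, ∑ b, ∑ d, f a b c d :=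
        Finset.sum_congr rfl fun a _ => Finset.sum_comm
    _ = ∑ c, ∑ a, ∑ b, ∑ d, f a b c d := Finset.sum_comm
    _ = ∑ c, ∑ a, ∑ d, ∑ b, f a b c d := Finset.sum_congr rfl fun c _ =>
        Finset.sum_congr rfl fun a _ => Finset.sum_comm
    _ = ∑ c, ∑ d, ∑ a, ∑ b, f a b c d := Finset.sum_congr rfl fun c _ => Finset.sum_comm

/-- Averaging argument picking one good codebook. -/
lemma aux_pick {Ω : Type} [Fintype Ω] (w : Ω → ℝ) (hw : ∀ o, 0 ≤ w o) (hw1 : ∑ o, w o = 1)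
    (X Y Z : Ω → ℝ) (e₁ e₂ e₃ : ℝ) (h1 : 0 < e₁) (h2 : 0 < e₂) (h3 : 0 < e₃)
    (hX0 : ∀ o, w o ≠ 0 → 0 ≤ X o) (hY0 : ∀ o, w o ≠ 0 → 0 ≤ Y o) (hZ0 : ∀ o, w o ≠ 0 → 0 ≤ Z o)
    (hX : ∑ o, w o * X o ≤ e₁) (hY : ∑ o, w o * Y o ≤ e₂) (hZ : ∑ o, w o * Z o ≤ e₃) :
    ∃ o, w o ≠ 0 ∧ X o ≤ 3 * e₁ ∧ Y o ≤ 3 * e₂ ∧ Z o ≤ 3 * e₃ := by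
  by_contra! hcon
  have key : ∀ o, w o ≠ 0 → 3 < X o / e₁ + Y o / e₂ + Z o / e₃ := by
    intro o ho
    have a1 := div_nonneg (hX0 o ho) h1.le
    have a2 := div_nonneg (hY0 o ho) h2.le
    have a3 := div_nonneg (hZ0 o ho) h3.le
    by_cases c1 : X o ≤ 3 * e₁
    · by_cases c2 : Y o ≤ 3 * e₂
      · have := (lt_div_iff₀ h3).2 (hcon o ho c1 c2)
        linarith
      · have := (lt_div_iff₀ h2).2 (not_le.1 c2)
        linarith
    · have := (lt_div_iff₀ h1).2 (not_le.1 c1)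
      linarith
  obtain ⟨o₀, ho₀⟩ : ∃ o, w o ≠ 0 := by
    by_contra! h
    simp [h] at hw1
  have hlt : ∑ o, w o * 3 < ∑ o, w o * (X o / e₁ + Y o / e₂ + Z o / e₃) := by
    refine Finset.sum_lt_sum (fun o _ => ?_) ⟨o₀, Finset.mem_univ _, ?_⟩
    · by_cases ho : w o = 0
      · simp [ho]
      · exact mul_le_mul_of_nonneg_left (key o ho).le (hw o)
    · exact mul_lt_mul_of_pos_left (key o₀ ho₀) ((hw o₀).lt_of_ne' ho₀)
  rw [← Finset.sum_mul, hw1] at hlt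
  have heq : ∑ o, w o * (X o / e₁ + Y o / e₂ + Z o / e₃)
      = (∑ o, w o * X o) / e₁ + (∑ o, w o * Y o) / e₂ + (∑ o, w o * Z o) / e₃ := by
    simp_rw [Finset.sum_div]
    rw [← Finset.sum_add_distrib, ← Finset.sum_add_distrib]
    refine Finset.sum_congr rfl fun o _ => ?_
    ring
  rw [heq] at hlt
  have := (div_le_one h1).2 hX
  have := (div_le_one h2).2 hY
  have := (div_le_one h3).2 hZ
  linarith

/-- first threshold test -/
def auxI1 {U V Z : Type} [Fintype U] [Fintype V] (pU : U → ℝ) (k : U → V → ℝ)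
    (T : V → Z → ℝ) (γ : ℝ) (v : V) (z : Z) : ℝ :=
  if Real.exp γ * auxP pU k T z < T v z then 1 else 0

/-- second threshold test -/
def auxI2 {U V Z : Type} [Fintype V] (k : U → V → ℝ)
    (T : V → Z → ℝ) (γ : ℝ) (u : U) (v : V) (z : Z) : ℝ :=
  if Real.exp γ * auxPU k T u z < T v z then 1 else 0

lemma aux_thr {P t γ κ : ℝ} (hP : 0 < P) (ht : 0 < t) (hγ : γ < κ) :
    1 - (if Real.exp γ * P < t then (1 : ℝ) else 0) ≤ |Real.log (t / P) - κ| * (κ - γ)⁻¹ := by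
  have hpos : 0 < κ - γ := by linarith
  split_ifs with h
  · have : 0 ≤ |Real.log (t / P) - κ| * (κ - γ)⁻¹ := by positivity
    linarith
  · have h1 : t / P ≤ Real.exp γ := by
      rw [div_le_iff₀ hP]; linarith
    have h2 : Real.log (t / P) ≤ γ := by
      rw [← Real.log_exp γ]; exact Real.log_le_log (by positivity) h1
    have h3 : κ - γ ≤ |Real.log (t / P) - κ| := by
      rw [abs_sub_comm]; exact le_trans (by linarith) (le_abs_self _)
    rw [← div_eq_mul_inv, sub_zero, le_div_iff₀ hpos]; linarith

lemma aux_thr2 {P t γ : ℝ} (hP : 0 ≤ P) (ht : 0 ≤ t) :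
    P * (if Real.exp γ * P < t then (1 : ℝ) else 0) ≤ Real.exp (-γ) * t := by
  split_ifs with h
  · have h1 : Real.exp (-γ) * (Real.exp γ * P) ≤ Real.exp (-γ) * t := by gcongr
    rw [← mul_assoc, ← Real.exp_add] at h1
    simpa using h1
  · simp; positivity

section
variable {Ω A B U V Z : Type} [Fintype Ω] [Fintype A] [Fintype B] [Nonempty A] [Nonempty B]
  [Fintype U] [Fintype V] [Fintype Z]
  {w : Ω → ℝ} {cu : Ω → A → U} {cv : Ω → A → B → V} {pU : U → ℝ} {k : U → V → ℝ}
  {T : V → Z → ℝ}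

open Classical in
/-- Union bound for threshold decoding errors. -/
def auxBad (pU : U → ℝ) (k : U → V → ℝ) (T : V → Z → ℝ) (γ₁ γ₂ : ℝ)
    (u : A → U) (v : A → B → V) (a : A) (b : B) (z : Z) : ℝ :=
  (1 - auxI1 pU k T γ₁ (v a b) z) + (1 - auxI2 k T γ₂ (u a) (v a b) z)
  + (∑ a', ∑ b', if a' = a then 0 else auxI1 pU k T γ₁ (v a' b') z)
  + ∑ b', if b' = b then 0 else auxI2 k T γ₂ (u a) (v a b') z

lemma AuxEns.errb (h : AuxEns w cu cv pU k) (hs : AuxSrc pU k T) (γ₁ γ₂ κ₁ κ₂ : ℝ)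
    (h1 : γ₁ < κ₁) (h2 : γ₂ < κ₂) (a : A) (b : B) :
    ∑ o, w o * ∑ z, T (cv o a b) z * auxBad pU k T γ₁ γ₂ (cu o) (cv o) a b z
      ≤ auxE3 pU k T (fun _ v z => |Real.log (T v z / auxP pU k T z) - κ₁|) * (κ₁ - γ₁)⁻¹
       + auxE3 pU k T (fun u v z => |Real.log (T v z / auxPU k T u z) - κ₂|) * (κ₂ - γ₂)⁻¹
       + (Fintype.card A : ℝ) * Fintype.card B * Real.exp (-γ₁)
       + (Fintype.card B : ℝ) * Real.exp (-γ₂) := by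
  classical
  have hI1 : ∀ v z, 0 ≤ auxI1 pU k T γ₁ v z := by intro v z; unfold auxI1; split_ifs <;> norm_num
  have hI2 : ∀ u v z, 0 ≤ auxI2 k T γ₂ u v z := by
    intro u v z; unfold auxI2; split_ifs <;> norm_num
  -- split
  have hsplit : ∑ o, w o * ∑ z, T (cv o a b) z * auxBad pU k T γ₁ γ₂ (cu o) (cv o) a b z
      = (∑ z, ∑ o, w o * (T (cv o a b) z * (1 - auxI1 pU k T γ₁ (cv o a b) z)))
      + (∑ z, ∑ o, w o * (T (cv o a b) z * (1 - auxI2 k T γ₂ (cu o a) (cv o a b) z)))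
      + (∑ a', ∑ b', ∑ z, ∑ o, w o * (T (cv o a b) z *
          (if a' = a then 0 else auxI1 pU k T γ₁ (cv o a' b') z)))
      + ∑ b', ∑ z, ∑ o, w o * (T (cv o a b) z *
          (if b' = b then 0 else auxI2 k T γ₂ (cu o a) (cv o a b') z)) := by
    have e1 : (∑ a', ∑ b', ∑ z, ∑ o, w o * (T (cv o a b) z *
          (if a' = a then 0 else auxI1 pU k T γ₁ (cv o a' b') z)))
        = ∑ z, ∑ o, w o * (T (cv o a b) z *
          ∑ a', ∑ b', (if a' = a then 0 else auxI1 pU k T γ₁ (cv o a' b') z)) := by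
      simp_rw [Finset.mul_sum]
      exact aux_sum_comm4 _
    have e2 : (∑ b', ∑ z, ∑ o, w o * (T (cv o a b) z *
          (if b' = b then 0 else auxI2 k T γ₂ (cu o a) (cv o a b') z)))
        = ∑ z, ∑ o, w o * (T (cv o a b) z *
          ∑ b', (if b' = b then 0 else auxI2 k T γ₂ (cu o a) (cv o a b') z)) := by
      simp_rw [Finset.mul_sum]
      rw [Finset.sum_comm]
      refine Finset.sum_congr rfl fun z _ => ?_
      rw [Finset.sum_comm]
    rw [e1, e2]
    have e3 : ∀ o, w o * ∑ z, T (cv o a b) z * auxBad pU k T γ₁ γ₂ (cu o) (cv o) a b z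
        = ∑ z, w o * (T (cv o a b) z * auxBad pU k T γ₁ γ₂ (cu o) (cv o) a b z) :=
      fun o => Finset.mul_sum _ _ _
    simp_rw [e3]
    rw [Finset.sum_comm]
    simp only [← Finset.sum_add_distrib]
    refine Finset.sum_congr rfl fun z _ => Finset.sum_congr rfl fun o _ => ?_
    unfold auxBad
    simp only [mul_add]
  rw [hsplit]
  have t1 : (∑ z, ∑ o, w o * (T (cv o a b) z * (1 - auxI1 pU k T γ₁ (cv o a b) z)))
      ≤ auxE3 pU k T (fun _ v z => |Real.log (T v z / auxP pU k T z) - κ₁|) * (κ₁ - γ₁)⁻¹ := by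
    rw [h.sum_E3 a b (fun _ v z => 1 - auxI1 pU k T γ₁ v z), ← auxE3_mul]
    refine hs.E3_mono fun u v z hu hk hT => ?_
    exact aux_thr (hs.P_pos hu hk hT) ((hs.T0 v z).lt_of_ne' hT) h1
  have t2 : (∑ z, ∑ o, w o * (T (cv o a b) z * (1 - auxI2 k T γ₂ (cu o a) (cv o a b) z)))
      ≤ auxE3 pU k T (fun u v z => |Real.log (T v z / auxPU k T u z) - κ₂|) * (κ₂ - γ₂)⁻¹ := by
    rw [h.sum_E3 a b (fun u v z => 1 - auxI2 k T γ₂ u v z), ← auxE3_mul]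
    refine hs.E3_mono fun u v z hu hk hT => ?_
    exact aux_thr (hs.PU_pos hk hT) ((hs.T0 v z).lt_of_ne' hT) h2
  have t3 : ∀ a' b', ∑ z, ∑ o, w o * (T (cv o a b) z *
          (if a' = a then 0 else auxI1 pU k T γ₁ (cv o a' b') z)) ≤ Real.exp (-γ₁) := by
    intro a' b'
    by_cases ha : a' = a
    · simp [ha]; positivity
    · simp only [if_neg ha]
      have : ∀ z, ∑ o, w o * (T (cv o a b) z * auxI1 pU k T γ₁ (cv o a' b') z)
          ≤ Real.exp (-γ₁) * auxP pU k T z := by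
        intro z
        have := h.ind a a' b b' (Ne.symm ha) (fun _ v => T v z)
          (fun _ v => auxI1 pU k T γ₁ v z)
        rw [this, AuxSrc.P_eq, Finset.mul_sum, ← AuxSrc.P_eq, Finset.mul_sum]
        refine Finset.sum_le_sum fun u _ => ?_
        rw [Finset.mul_sum, Finset.mul_sum]
        refine Finset.sum_le_sum fun v _ => ?_
        have h5 := aux_thr2 (γ := γ₁) (hs.P0 z) (hs.T0 v z)
        have h6 := mul_le_mul_of_nonneg_left h5 (mul_nonneg (hs.pU0 u) (hs.k0 u v))
        rw [AuxSrc.P_eq]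
        unfold auxI1
        linarith
      refine (Finset.sum_le_sum fun z _ => this z).trans ?_
      rw [← Finset.mul_sum, hs.P1, mul_one]
  have t4 : ∀ b', ∑ z, ∑ o, w o * (T (cv o a b) z *
          (if b' = b then 0 else auxI2 k T γ₂ (cu o a) (cv o a b') z)) ≤ Real.exp (-γ₂) := by
    intro b'
    by_cases hb : b' = b
    · simp [hb]; positivity
    · simp only [if_neg hb]
      have : ∀ z, ∑ o, w o * (T (cv o a b) z * auxI2 k T γ₂ (cu o a) (cv o a b') z)
          ≤ Real.exp (-γ₂) * auxP pU k T z := by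
        intro z
        have := h.sat a b b' (Ne.symm hb) (fun _ v => T v z)
          (fun u v => auxI2 k T γ₂ u v z)
        rw [this, ← AuxSrc.P_eq, Finset.mul_sum]
        refine Finset.sum_le_sum fun u _ => ?_
        change pU u * (auxPU k T u z * _) ≤ _
        rw [Finset.mul_sum, Finset.mul_sum, Finset.mul_sum]
        refine Finset.sum_le_sum fun v _ => ?_
        have h5 := aux_thr2 (γ := γ₂) (hs.PU0 u z) (hs.T0 v z)
        have h6 := mul_le_mul_of_nonneg_left h5 (mul_nonneg (hs.pU0 u) (hs.k0 u v))
        unfold auxI2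
        linarith
      refine (Finset.sum_le_sum fun z _ => this z).trans ?_
      rw [← Finset.mul_sum, hs.P1, mul_one]
  have t3' := Finset.sum_le_sum fun a' (_ : a' ∈ (Finset.univ : Finset A)) =>
    Finset.sum_le_sum fun b' (_ : b' ∈ (Finset.univ : Finset B)) => t3 a' b'
  have t4' := Finset.sum_le_sum fun b' (_ : b' ∈ (Finset.univ : Finset B)) => t4 b'
  simp only [Finset.sum_const, Finset.card_univ, nsmul_eq_mul] at t3' t4'
  rw [← mul_assoc] at t3'
  linarith

end


def auxKL {Z : Type} [Fintype Z] (p q : Z → ℝ) : ℝ := ∑ z, p z * Real.log (p z / q z)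

lemma auxKL_nonneg {Z : Type} [Fintype Z] (p q : Z → ℝ) (hp : ∀ z, 0 ≤ p z) (hq : ∀ z, 0 ≤ q z)
    (hpq : ∀ z, q z = 0 → p z = 0) (hp1 : ∑ z, p z = 1) (hq1 : ∑ z, q z = 1) : 0 ≤ auxKL p q := by
  have := aux_gibbs p q hp hq hpq
  unfold auxKL; linarith

lemma aux_avg_sum {Ω J : Type} [Fintype Ω] [Fintype J] [Nonempty J] (w : Ω → ℝ)
    (X : Ω → J → ℝ) (e : ℝ) (h : ∀ j, ∑ o, w o * X o j ≤ e) :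
    ∑ o, w o * ((Fintype.card J : ℝ)⁻¹ * ∑ j, X o j) ≤ e := by
  have hN : (0 : ℝ) < Fintype.card J := by exact_mod_cast Fintype.card_pos
  have : ∑ o, w o * ((Fintype.card J : ℝ)⁻¹ * ∑ j, X o j)
      = (Fintype.card J : ℝ)⁻¹ * ∑ j, ∑ o, w o * X o j := by
    rw [Finset.sum_comm, Finset.mul_sum]
    refine Finset.sum_congr rfl fun o _ => ?_
    rw [← Finset.mul_sum]; ring
  rw [this]
  have h2 := Finset.sum_le_sum fun j (_ : j ∈ (Finset.univ : Finset J)) => h j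
  simp only [Finset.sum_const, Finset.card_univ, nsmul_eq_mul] at h2
  calc _ ≤ (Fintype.card J : ℝ)⁻¹ * (Fintype.card J * e) := by gcongr
    _ = e := by field_simp

lemma aux_mix_sum {J Z : Type} [Fintype J] [Nonempty J] [Fintype Z] (g : J → Z → ℝ)
    (h : ∀ j, ∑ z, g j z = 1) : ∑ z, (Fintype.card J : ℝ)⁻¹ * ∑ j, g j z = 1 := by
  have hN : (0 : ℝ) < Fintype.card J := by exact_mod_cast Fintype.card_pos
  rw [← Finset.mul_sum, Finset.sum_comm]
  simp_rw [h]
  simp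

lemma aux_mix_nonneg {J Z : Type} [Fintype J] (g : J → Z → ℝ)
    (h : ∀ j z, 0 ≤ g j z) (z : Z) : 0 ≤ (Fintype.card J : ℝ)⁻¹ * ∑ j, g j z :=
  mul_nonneg (by positivity) (Finset.sum_nonneg fun j _ => h j z)

lemma auxBad_nonneg {A B U V Z : Type} [Fintype A] [Fintype B] [Fintype U] [Fintype V]
    (pU : U → ℝ) (k : U → V → ℝ) (T : V → Z → ℝ) (γ₁ γ₂ : ℝ)
    (u : A → U) (v : A → B → V) (a : A) (b : B) (z : Z) : 0 ≤ auxBad pU k T γ₁ γ₂ u v a b z := by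
  have hI1 : ∀ v z, 0 ≤ auxI1 pU k T γ₁ v z ∧ auxI1 pU k T γ₁ v z ≤ 1 := by
    intro v z; unfold auxI1; split_ifs <;> norm_num
  have hI2 : ∀ u v z, 0 ≤ auxI2 k T γ₂ u v z ∧ auxI2 k T γ₂ u v z ≤ 1 := by
    intro u v z; unfold auxI2; split_ifs <;> norm_num
  unfold auxBad
  refine add_nonneg (add_nonneg (add_nonneg ?_ ?_) ?_) ?_
  · linarith [(hI1 (v a b) z).2]
  · linarith [(hI2 (u a) (v a b) z).2]
  · refine Finset.sum_nonneg fun a' _ => Finset.sum_nonneg fun b' _ => ?_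
    split_ifs
    · exact le_rfl
    · exact (hI1 _ _).1
  · refine Finset.sum_nonneg fun b' _ => ?_
    split_ifs
    · exact le_rfl
    · exact (hI2 _ _ _).1

/-- One-shot superposition coding with all three guarantees. -/
lemma aux_oneshot {S L₀ M₁ S' L₁ U V Y Z₁ Z₂ : Type}
    [Fintype S] [Fintype L₀] [Fintype M₁] [Fintype S'] [Fintype L₁]
    [Nonempty S] [Nonempty L₀] [Nonempty M₁] [Nonempty S'] [Nonempty L₁]
    [Fintype U] [Fintype V] [Fintype Y] [Fintype Z₁] [Fintype Z₂]
    (pU : U → ℝ) (k : U → V → ℝ) (TY : V → Y → ℝ) (T₁ : V → Z₁ → ℝ) (T₂ : V → Z₂ → ℝ)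
    (hY : AuxSrc pU k TY) (h₁ : AuxSrc pU k T₁) (h₂ : AuxSrc pU k T₂)
    (γ₁ γ₂ κ₁ κ₂ ι₁ ι₂ θ : ℝ) (hγ₁ : γ₁ < κ₁) (hγ₂ : γ₂ < κ₂)
    (hι₁ : ι₁ ≤ Real.log (Fintype.card L₀))
    (hι₂ : ι₂ ≤ Real.log ((Fintype.card L₀ : ℝ) * Fintype.card L₁))
    (hθ : θ ≤ Real.log (Fintype.card (S' × L₁)))
    (e₁ e₂ e₃ : ℝ) (he₁ : 0 < e₁) (he₂ : 0 < e₂) (he₃ : 0 < e₃)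
    (hE₁ : auxE3 pU k TY (fun _ v z => |Real.log (TY v z / auxP pU k TY z) - κ₁|) * (κ₁ - γ₁)⁻¹
       + auxE3 pU k TY (fun u v z => |Real.log (TY v z / auxPU k TY u z) - κ₂|) * (κ₂ - γ₂)⁻¹
       + (Fintype.card (S × L₀) : ℝ) * Fintype.card (M₁ × S' × L₁) * Real.exp (-γ₁)
       + (Fintype.card (M₁ × S' × L₁) : ℝ) * Real.exp (-γ₂) ≤ e₁)
    (hE₂ : Real.log 4
        + auxE3 pU k T₂ (fun u _ z => |Real.log (auxPU k T₂ u z / auxP pU k T₂ z) - ι₁|)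
        + auxE3 pU k T₂ (fun _ v z => |Real.log (T₂ v z / auxP pU k T₂ z) - ι₂|) ≤ e₂)
    (hE₃ : Real.log 2 + auxE3 pU k T₁ (fun u v z => |Real.log (T₁ v z / auxPU k T₁ u z) - θ|)
        ≤ e₃) :
    ∃ (u : S × L₀ → U) (v : S × L₀ → M₁ × S' × L₁ → V),
      (∀ a b, pU (u a) ≠ 0 ∧ k (u a) (v a b) ≠ 0) ∧
      (Fintype.card ((S × L₀) × (M₁ × S' × L₁)) : ℝ)⁻¹ *
        ∑ j : (S × L₀) × (M₁ × S' × L₁), ∑ y, TY (v j.1 j.2) y *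
          auxBad pU k TY γ₁ γ₂ u v j.1 j.2 y ≤ 3 * e₁ ∧
      (Fintype.card (M₁ × S × S') : ℝ)⁻¹ * ∑ j : M₁ × S × S',
        auxKL (fun z => (Fintype.card (L₀ × L₁) : ℝ)⁻¹ *
          ∑ l : L₀ × L₁, T₂ (v (j.2.1, l.1) (j.1, j.2.2, l.2)) z) (auxP pU k T₂) ≤ 3 * e₂ ∧
      (Fintype.card (M₁ × S × L₀) : ℝ)⁻¹ * ∑ j : M₁ × S × L₀,
        auxKL (fun z => (Fintype.card (S' × L₁) : ℝ)⁻¹ *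
          ∑ b : S' × L₁, T₁ (v j.2 (j.1, b)) z) (auxPU k T₁ (u j.2)) ≤ 3 * e₃ := by
  classical
  obtain ⟨Ω, iΩ, w, cu, cv, hens⟩ := aux_ens_exists (S × L₀) (M₁ × S' × L₁) pU k
    hY.pU0 hY.pU1 hY.k0 hY.k1
  obtain ⟨o, ho, b1, b2, b3⟩ := aux_pick w hens.nonneg hens.total
    (fun o => (Fintype.card ((S × L₀) × (M₁ × S' × L₁)) : ℝ)⁻¹ *
        ∑ j : (S × L₀) × (M₁ × S' × L₁), ∑ y, TY (cv o j.1 j.2) y *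
          auxBad pU k TY γ₁ γ₂ (cu o) (cv o) j.1 j.2 y)
    (fun o => (Fintype.card (M₁ × S × S') : ℝ)⁻¹ * ∑ j : M₁ × S × S',
        auxKL (fun z => (Fintype.card (L₀ × L₁) : ℝ)⁻¹ *
          ∑ l : L₀ × L₁, T₂ (cv o (j.2.1, l.1) (j.1, j.2.2, l.2)) z) (auxP pU k T₂))
    (fun o => (Fintype.card (M₁ × S × L₀) : ℝ)⁻¹ * ∑ j : M₁ × S × L₀,
        auxKL (fun z => (Fintype.card (S' × L₁) : ℝ)⁻¹ *
          ∑ b : S' × L₁, T₁ (cv o j.2 (j.1, b)) z) (auxPU k T₁ (cu o j.2)))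
    e₁ e₂ e₃ he₁ he₂ he₃
    (by
      intro o ho
      refine mul_nonneg (by positivity) (Finset.sum_nonneg fun j _ => Finset.sum_nonneg fun y _ =>
        mul_nonneg (hY.T0 _ _) ?_)
      exact auxBad_nonneg _ _ _ _ _ _ _ _ _ _)
    (by
      intro o ho
      refine mul_nonneg (by positivity) (Finset.sum_nonneg fun j _ => ?_)
      refine auxKL_nonneg _ _ (aux_mix_nonneg _ fun l z => h₂.T0 _ _) (fun z => h₂.P0 z) ?_
        (aux_mix_sum _ fun l => h₂.T1 _) h₂.P1
      intro z hz
      rw [Finset.sum_eq_zero, mul_zero]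
      intro l _
      by_contra hne
      have hsp := hens.supp o ho (j.2.1, l.1) (j.1, j.2.2, l.2)
      exact (h₂.P_pos hsp.1 hsp.2 hne).ne' hz)
    (by
      intro o ho
      refine mul_nonneg (by positivity) (Finset.sum_nonneg fun j _ => ?_)
      refine auxKL_nonneg _ _ (aux_mix_nonneg _ fun l z => h₁.T0 _ _) (fun z => h₁.PU0 _ z) ?_
        (aux_mix_sum _ fun l => h₁.T1 _) (h₁.PU1 _)
      intro z hz
      rw [Finset.sum_eq_zero, mul_zero]
      intro l _
      by_contra hne
      exact (h₁.PU_pos (hens.supp o ho _ _).2 hne).ne' hz)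
    (aux_avg_sum w (fun o (j : (S × L₀) × (M₁ × S' × L₁)) => ∑ y, TY (cv o j.1 j.2) y *
          auxBad pU k TY γ₁ γ₂ (cu o) (cv o) j.1 j.2 y) e₁ fun j =>
      (hens.errb hY γ₁ γ₂ κ₁ κ₂ hγ₁ hγ₂ j.1 j.2).trans hE₁)
    (aux_avg_sum w (fun o (j : M₁ × S × S') =>
        auxKL (fun z => (Fintype.card (L₀ × L₁) : ℝ)⁻¹ *
          ∑ l : L₀ × L₁, T₂ (cv o (j.2.1, l.1) (j.1, j.2.2, l.2)) z) (auxP pU k T₂)) e₂ fun j => by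
      have hc := (hens.comap (fun l : L₀ => (j.2.1, l)) (fun x y h => by simpa using h)
        (fun l : L₁ => (j.1, j.2.2, l)) (fun x y h => by simpa using h)).cover2 h₂ ι₁ ι₂ hι₁ hι₂
      refine le_trans (le_of_eq ?_) (hc.trans hE₂)
      refine Finset.sum_congr rfl fun o _ => ?_
      simp only [auxKL, Fintype.sum_prod_type, Fintype.card_prod, Nat.cast_mul])
    (aux_avg_sum w (fun o (j : M₁ × S × L₀) =>
        auxKL (fun z => (Fintype.card (S' × L₁) : ℝ)⁻¹ *
          ∑ b : S' × L₁, T₁ (cv o j.2 (j.1, b)) z) (auxPU k T₁ (cu o j.2))) e₃ fun j => by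
      have hc := (hens.comap (fun a : S × L₀ => a) (fun x y h => h)
        (fun b : S' × L₁ => (j.1, b)) (fun x y h => by simpa using h)).cover1 h₁ θ j.2 hθ
      exact hc.trans hE₃)
  exact ⟨cu o, cv o, hens.supp o ho, b1, b2, b3⟩


def auxBlk {α β : Type} (n : ℕ) (T : α → β → ℝ) (v : Fin n → α) (z : Fin n → β) : ℝ :=
  ∏ i, T (v i) (z i)

def auxPB {α : Type} (n : ℕ) (p : α → ℝ) (u : Fin n → α) : ℝ := ∏ i, p (u i)

lemma auxBlk_sum {α β : Type} [Fintype β] (n : ℕ) (T : α → β → ℝ) (h : ∀ v, ∑ z, T v z = 1)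
    (v : Fin n → α) : ∑ z, auxBlk n T v z = 1 := by
  unfold auxBlk
  rw [aux_pi_sum (fun i z => T (v i) z)]
  simp [h]

section
variable {U V Z : Type} [Fintype U] [Fintype V] [Fintype Z]
    {pU : U → ℝ} {k : U → V → ℝ} {T : V → Z → ℝ}

lemma AuxSrc.blk (h : AuxSrc pU k T) (n : ℕ) : AuxSrc (auxPB n pU) (auxBlk n k) (auxBlk n T) where
  pU0 := fun u => Finset.prod_nonneg fun i _ => h.pU0 _
  pU1 := aux_pi_total pU h.pU1
  k0 := fun u v => Finset.prod_nonneg fun i _ => h.k0 _ _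
  k1 := auxBlk_sum n k h.k1
  T0 := fun u v => Finset.prod_nonneg fun i _ => h.T0 _ _
  T1 := auxBlk_sum n T h.T1

lemma auxPU_blk (k : U → V → ℝ) (T : V → Z → ℝ) (n : ℕ) (u : Fin n → U) (z : Fin n → Z) :
    auxPU (auxBlk n k) (auxBlk n T) u z = ∏ i, auxPU k T (u i) (z i) := by
  unfold auxPU auxBlk
  simp_rw [← Finset.prod_mul_distrib]
  exact aux_pi_sum (fun i v => k (u i) v * T v (z i))

lemma auxP_blk (pU : U → ℝ) (k : U → V → ℝ) (T : V → Z → ℝ) (n : ℕ) (z : Fin n → Z) :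
    auxP (auxPB n pU) (auxBlk n k) (auxBlk n T) z = ∏ i, auxP pU k T (z i) := by
  unfold auxP
  simp_rw [auxPU_blk]
  unfold auxPB
  simp_rw [← Finset.prod_mul_distrib]
  exact aux_pi_sum (fun i u => pU u * auxPU k T u (z i))

lemma aux_sum_triple (n : ℕ) (F : (Fin n → U) → (Fin n → V) → (Fin n → Z) → ℝ) :
    ∑ x : Fin n → U × V × Z, F (fun i => (x i).1) (fun i => (x i).2.1) (fun i => (x i).2.2)
      = ∑ u, ∑ v, ∑ z, F u v z := by
  rw [← (Equiv.arrowProdEquivProdArrow (Fin n) (fun _ => U) (fun _ => V × Z)).symm.sum_comp,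
    Fintype.sum_prod_type]
  refine Finset.sum_congr rfl fun u _ => ?_
  rw [← (Equiv.arrowProdEquivProdArrow (Fin n) (fun _ => V) (fun _ => Z)).symm.sum_comp,
    Fintype.sum_prod_type]
  rfl

lemma AuxSrc.moment (h : AuxSrc pU k T) (r : U → V → Z → ℝ)
    (hr : ∀ u v z, pU u ≠ 0 → k u v ≠ 0 → T v z ≠ 0 → r u v z ≠ 0) :
    ∃ C : ℝ, 0 ≤ C ∧ ∀ n : ℕ, 0 < n →
      auxE3 (auxPB n pU) (auxBlk n k) (auxBlk n T) (fun u v z =>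
        |Real.log (∏ i, r (u i) (v i) (z i)) - n * auxE3 pU k T (fun u v z => Real.log (r u v z))|)
      ≤ C * √n := by
  let p : U × V × Z → ℝ := fun s => pU s.1 * k s.1 s.2.1 * T s.2.1 s.2.2
  let f : U × V × Z → ℝ := fun s => Real.log (r s.1 s.2.1 s.2.2)
  have hp : ∀ s, 0 ≤ p s := fun s => mul_nonneg (mul_nonneg (h.pU0 _) (h.k0 _ _)) (h.T0 _ _)
  have hp1 : ∑ s, p s = 1 := by
    have := h.E3_const 1
    simp only [auxE3, mul_one] at this
    simp_rw [Fintype.sum_prod_type]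
    exact this
  obtain ⟨C, hC, hm⟩ := aux_moment p hp hp1 f
  refine ⟨C, hC, fun n hn => le_trans (le_of_eq ?_) (hm n hn)⟩
  have hμ : ∑ s, p s * f s = auxE3 pU k T (fun u v z => Real.log (r u v z)) := by
    simp_rw [Fintype.sum_prod_type]
    rfl
  rw [hμ]
  rw [(h.blk n).E3_congr (G := fun u v z => |∑ i, f (u i, v i, z i) -
    n * auxE3 pU k T (fun u v z => Real.log (r u v z))|)]
  · unfold auxE3
    rw [← aux_sum_triple]
    refine Finset.sum_congr rfl fun x _ => ?_
    simp only [auxPB, auxBlk, ← Finset.prod_mul_distrib]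
    rfl
  · intro u v z hu hk hT
    rw [Real.log_prod]
    intro i hi
    exact hr _ _ _ (Finset.prod_ne_zero_iff.1 hu i hi) (Finset.prod_ne_zero_iff.1 hk i hi)
      (Finset.prod_ne_zero_iff.1 hT i hi)

end


lemma auxBad_ge_one {A B U V Z : Type} [Fintype A] [Fintype B] [Fintype U] [Fintype V]
    (pU : U → ℝ) (k : U → V → ℝ) (T : V → Z → ℝ) (γ₁ γ₂ : ℝ)
    (u : A → U) (v : A → B → V) (a : A) (b : B) (z : Z)
    (h : (Real.exp γ₁ * auxP pU k T z < T (v a b) z ∧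
        Real.exp γ₂ * auxPU k T (u a) z < T (v a b) z) →
      ∃ a' b', (a' ≠ a ∨ b' ≠ b) ∧ Real.exp γ₁ * auxP pU k T z < T (v a' b') z ∧
        Real.exp γ₂ * auxPU k T (u a') z < T (v a' b') z) :
    1 ≤ auxBad pU k T γ₁ γ₂ u v a b z := by
  classical
  have hI1 : ∀ v z, 0 ≤ auxI1 pU k T γ₁ v z ∧ auxI1 pU k T γ₁ v z ≤ 1 := by
    intro v z; unfold auxI1; split_ifs <;> norm_num
  have hI2 : ∀ u v z, 0 ≤ auxI2 k T γ₂ u v z ∧ auxI2 k T γ₂ u v z ≤ 1 := by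
    intro u v z; unfold auxI2; split_ifs <;> norm_num
  have hdef : auxBad pU k T γ₁ γ₂ u v a b z =
    (1 - auxI1 pU k T γ₁ (v a b) z) + (1 - auxI2 k T γ₂ (u a) (v a b) z)
    + (∑ a', ∑ b', if a' = a then 0 else auxI1 pU k T γ₁ (v a' b') z)
    + ∑ b', if b' = b then 0 else auxI2 k T γ₂ (u a) (v a b') z := by
    unfold auxBad; congr!
  have q1 := (hI1 (v a b) z).2
  have q2 := (hI2 (u a) (v a b) z).2
  have q30 : ∀ a' b', 0 ≤ if a' = a then 0 else auxI1 pU k T γ₁ (v a' b') z := by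
    intro a' b'; split_ifs
    · exact le_rfl
    · exact (hI1 _ _).1
  have q40 : ∀ b', 0 ≤ if b' = b then 0 else auxI2 k T γ₂ (u a) (v a b') z := by
    intro b'; split_ifs
    · exact le_rfl
    · exact (hI2 _ _ _).1
  have q3 := Finset.sum_nonneg fun a' (_ : a' ∈ (Finset.univ : Finset A)) =>
    Finset.sum_nonneg fun b' (_ : b' ∈ (Finset.univ : Finset B)) => q30 a' b'
  have q4 := Finset.sum_nonneg fun b' (_ : b' ∈ (Finset.univ : Finset B)) => q40 b'
  rw [hdef]
  by_cases p1 : Real.exp γ₁ * auxP pU k T z < T (v a b) z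
  · by_cases p2 : Real.exp γ₂ * auxPU k T (u a) z < T (v a b) z
    · obtain ⟨a', b', hne, p1', p2'⟩ := h ⟨p1, p2⟩
      by_cases ha : a' = a
      · subst ha
        have hb : b' ≠ b := by
          rcases hne with h | h
          · exact absurd rfl h
          · exact h
        have h5 := Finset.single_le_sum (fun b' (_ : b' ∈ (Finset.univ : Finset B)) => q40 b')
          (Finset.mem_univ b')
        have : auxI2 k T γ₂ (u a') (v a' b') z = 1 := by unfold auxI2; rw [if_pos p2']
        simp only [if_neg hb, this] at h5
        linarith
      · have h5 := Finset.single_le_sum (fun a' (_ : a' ∈ (Finset.univ : Finset A)) =>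
          Finset.sum_nonneg fun b' (_ : b' ∈ (Finset.univ : Finset B)) => q30 a' b')
          (Finset.mem_univ a')
        have h6 := Finset.single_le_sum (fun b' (_ : b' ∈ (Finset.univ : Finset B)) => q30 a' b')
          (Finset.mem_univ b')
        have : auxI1 pU k T γ₁ (v a' b') z = 1 := by unfold auxI1; rw [if_pos p1']
        simp only [if_neg ha, this] at h5 h6
        linarith
    · have : auxI2 k T γ₂ (u a) (v a b) z = 0 := by unfold auxI2; rw [if_neg p2]
      linarith
  · have : auxI1 pU k T γ₁ (v a b) z = 0 := by unfold auxI1; rw [if_neg p1]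
    linarith

lemma aux_mutInfo_eq {α β : Type} [Fintype α] [Fintype β] (p : α × β → ℝ) :
    mutInfo p * Real.log 2 = ∑ a, ∑ b,
      p (a, b) * Real.log (p (a, b) / ((∑ b', p (a, b')) * ∑ a', p (a', b))) := by
  have h2 : Real.log 2 ≠ 0 := (Real.log_pos (by norm_num)).ne'
  unfold mutInfo
  rw [Finset.sum_mul, Fintype.sum_prod_type]
  refine Finset.sum_congr rfl fun a _ => Finset.sum_congr rfl fun b _ => ?_
  unfold Real.logb
  field_simp

lemma aux_mutInfo_le {M Z : Type} [Fintype M] [Nonempty M] [Fintype Z] (J : M × Z → ℝ)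
    (P : M → Z → ℝ) (hJ : ∀ m z, J (m, z) = (Fintype.card M : ℝ)⁻¹ * P m z)
    (Q : Z → ℝ) (hP0 : ∀ m z, 0 ≤ P m z) (hP1 : ∀ m, ∑ z, P m z = 1)
    (hQ0 : ∀ z, 0 ≤ Q z) (hQ1 : ∑ z, Q z = 1) (hPQ : ∀ m z, Q z = 0 → P m z = 0) :
    mutInfo J * Real.log 2 ≤ (Fintype.card M : ℝ)⁻¹ * ∑ m, auxKL (P m) Q := by
  rw [aux_mutInfo_eq]
  set N : ℝ := (Fintype.card M : ℝ) with hN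
  have hN0 : 0 < N := by rw [hN]; exact_mod_cast Fintype.card_pos
  set R : Z → ℝ := fun z => ∑ m, J (m, z) with hR
  have hR0 : ∀ z, 0 ≤ R z := fun z => Finset.sum_nonneg fun m _ => by
    rw [hJ]; exact mul_nonneg (inv_nonneg.2 hN0.le) (hP0 _ _)
  have hR1 : ∑ z, R z = 1 := by
    simp only [hR]
    rw [Finset.sum_comm]
    simp_rw [hJ, ← Finset.mul_sum, hP1]
    simp [← hN]
  have hRQ : ∀ z, Q z = 0 → R z = 0 := fun z hz => Finset.sum_eq_zero fun m _ => by
    rw [hJ, hPQ m z hz, mul_zero]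
  have hg := aux_gibbs R Q hR0 hQ0 hRQ
  have hrow : ∀ m, ∑ z, J (m, z) = N⁻¹ := by
    intro m; simp_rw [hJ, ← Finset.mul_sum, hP1, mul_one]
  have hterm : ∀ m z, J (m, z) * Real.log (J (m, z) / ((∑ z', J (m, z')) * ∑ m', J (m', z)))
      = N⁻¹ * (P m z * Real.log (P m z / Q z)) - J (m, z) * Real.log (R z / Q z) := by
    intro m z
    rw [hrow]
    change J (m, z) * Real.log (J (m, z) / (N⁻¹ * R z)) = _
    rcases (hP0 m z).eq_or_lt with h | h
    · rw [hJ, ← h]; simp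
    · have hJp : 0 < J (m, z) := by rw [hJ]; positivity
      have hQp : 0 < Q z := (hQ0 z).lt_of_ne fun h0 => h.ne' (hPQ m z h0.symm)
      have hRp : 0 < R z := lt_of_lt_of_le hJp (Finset.single_le_sum (f := fun m => J (m, z))
        (fun m _ => by rw [hJ]; exact mul_nonneg (inv_nonneg.2 hN0.le) (hP0 _ _))
        (Finset.mem_univ m))
      have : J (m, z) / (N⁻¹ * R z) = P m z / Q z / (R z / Q z) := by
        rw [hJ]; field_simp
      rw [this, Real.log_div (by positivity) (by positivity), hJ]; ring
  simp_rw [hterm, Finset.sum_sub_distrib]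
  have e1 : ∑ m, ∑ z, J (m, z) * Real.log (R z / Q z) = ∑ z, R z * Real.log (R z / Q z) := by
    rw [Finset.sum_comm]
    refine Finset.sum_congr rfl fun z _ => ?_
    rw [← Finset.sum_mul]
  rw [e1]
  have e2 : ∑ m, ∑ z, N⁻¹ * (P m z * Real.log (P m z / Q z)) = N⁻¹ * ∑ m, auxKL (P m) Q := by
    unfold auxKL
    simp_rw [Finset.mul_sum]
  rw [e2]
  linarith

lemma auxKL_convex {A Z : Type} [Fintype A] [Nonempty A] [Fintype Z] (P Q : A → Z → ℝ)
    (hP0 : ∀ a z, 0 ≤ P a z) (hQ0 : ∀ a z, 0 ≤ Q a z) (hPQ : ∀ a z, Q a z = 0 → P a z = 0) :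
    auxKL (fun z => (Fintype.card A : ℝ)⁻¹ * ∑ a, P a z)
        (fun z => (Fintype.card A : ℝ)⁻¹ * ∑ a, Q a z)
      ≤ (Fintype.card A : ℝ)⁻¹ * ∑ a, auxKL (P a) (Q a) := by
  set N : ℝ := (Fintype.card A : ℝ) with hN
  have hN0 : 0 < N := by rw [hN]; exact_mod_cast Fintype.card_pos
  unfold auxKL
  rw [Finset.sum_comm, Finset.mul_sum]
  refine Finset.sum_le_sum fun z _ => ?_
  have := aux_logsum (fun a => P a z) (fun a => Q a z) (fun a => hP0 a z) (fun a => hQ0 a z)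
    (fun a => hPQ a z)
  rw [mul_div_mul_left _ _ (inv_ne_zero hN0.ne'), mul_assoc]
  exact mul_le_mul_of_nonneg_left this (inv_nonneg.2 hN0.le)

section
variable {X Y Z₁ Z₂ : Type} [Fintype X] [Fintype Y] [Fintype Z₁] [Fintype Z₂]

lemma aux_blk_WY (W : X → Y × Z₁ × Z₂ → ℝ) (n : ℕ) (xs : Fin n → X) (ys : Fin n → Y) :
    ∑ z1s : Fin n → Z₁, ∑ z2s : Fin n → Z₂, ∏ i, W (xs i) (ys i, z1s i, z2s i)
      = auxBlk n (WY W) xs ys := by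
  have : ∀ z1s : Fin n → Z₁, ∑ z2s : Fin n → Z₂, ∏ i, W (xs i) (ys i, z1s i, z2s i)
      = ∏ i, ∑ z₂, W (xs i) (ys i, z1s i, z₂) := fun z1s =>
    aux_pi_sum (fun i z₂ => W (xs i) (ys i, z1s i, z₂))
  simp_rw [this]
  exact aux_pi_sum (fun i z₁ => ∑ z₂, W (xs i) (ys i, z₁, z₂))

lemma aux_blk_WZ1 (W : X → Y × Z₁ × Z₂ → ℝ) (n : ℕ) (xs : Fin n → X) (z1s : Fin n → Z₁) :
    ∑ ys : Fin n → Y, ∑ z2s : Fin n → Z₂, ∏ i, W (xs i) (ys i, z1s i, z2s i)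
      = auxBlk n (WZ1 W) xs z1s := by
  have : ∀ ys : Fin n → Y, ∑ z2s : Fin n → Z₂, ∏ i, W (xs i) (ys i, z1s i, z2s i)
      = ∏ i, ∑ z₂, W (xs i) (ys i, z1s i, z₂) := fun ys =>
    aux_pi_sum (fun i z₂ => W (xs i) (ys i, z1s i, z₂))
  simp_rw [this]
  exact aux_pi_sum (fun i y => ∑ z₂, W (xs i) (y, z1s i, z₂))

lemma aux_blk_WZ2 (W : X → Y × Z₁ × Z₂ → ℝ) (n : ℕ) (xs : Fin n → X) (z2s : Fin n → Z₂) :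
    ∑ ys : Fin n → Y, ∑ z1s : Fin n → Z₁, ∏ i, W (xs i) (ys i, z1s i, z2s i)
      = auxBlk n (WZ2 W) xs z2s := by
  have : ∀ ys : Fin n → Y, ∑ z1s : Fin n → Z₁, ∏ i, W (xs i) (ys i, z1s i, z2s i)
      = ∏ i, ∑ z₁, W (xs i) (ys i, z₁, z2s i) := fun ys =>
    aux_pi_sum (fun i z₁ => W (xs i) (ys i, z₁, z2s i))
  simp_rw [this]
  exact aux_pi_sum (fun i y => ∑ z₁, W (xs i) (y, z₁, z2s i))

/-- The stochastic encoder built from a codebook. -/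
def auxEnc {M L V : Type} [Fintype L] (n : ℕ) (c : V → X → ℝ) (vv : M → L → Fin n → V)
    (m : M) (xs : Fin n → X) : ℝ :=
  (Fintype.card L : ℝ)⁻¹ * ∑ l, auxBlk n c (vv m l) xs

lemma aux_enc_out {M L V Z : Type} [Fintype L] [Fintype V] [Fintype Z] (n : ℕ) (c : V → X → ℝ)
    (vv : M → L → Fin n → V) (m : M) (K : X → Z → ℝ) (r : ℝ) (zs : Fin n → Z) :
    ∑ xs, r * auxEnc n c vv m xs * auxBlk n K xs zs
      = r * ((Fintype.card L : ℝ)⁻¹ * ∑ l, auxBlk n (auxPU c K) (vv m l) zs) := by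
  have : ∀ l, auxBlk n (auxPU c K) (vv m l) zs
      = ∑ xs, auxBlk n c (vv m l) xs * auxBlk n K xs zs := fun l =>
    (auxPU_blk c K n (vv m l) zs).symm
  simp_rw [this]
  rw [Finset.sum_comm, Finset.mul_sum, Finset.mul_sum]
  refine Finset.sum_congr rfl fun xs _ => ?_
  unfold auxEnc
  rw [← Finset.sum_mul]; ring

end


/-- index bookkeeping for messages and codewords -/
def auxPhi {K₁ K₂ s s' l₀ l₁ : ℕ} (e : Fin K₂ ≃ Fin s × Fin s') :
    (Fin K₁ × Fin K₂) × (Fin l₀ × Fin l₁) ≃ (Fin s × Fin l₀) × (Fin K₁ × Fin s' × Fin l₁) where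
  toFun p := (((e p.1.2).1, p.2.1), (p.1.1, (e p.1.2).2, p.2.2))
  invFun j := ((j.2.1, e.symm (j.1.1, j.2.2.1)), (j.1.2, j.2.2.2))
  left_inv p := by simp
  right_inv j := by simp

section
variable {X Y Z₁ Z₂ V U : Type} [Fintype X] [Fintype Y] [Fintype Z₁] [Fintype Z₂] [Fintype V]
  [Fintype U]

lemma aux_sumsY {n K₁ K₂ : ℕ} (W : X → Y × Z₁ × Z₂ → ℝ)
    (enc : Fin K₁ × Fin K₂ → (Fin n → X) → ℝ) (m : Fin K₁ × Fin K₂) (xs : Fin n → X)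
    (ys : Fin n → Y) :
    ∑ z1s, ∑ z2s, codeJoint W enc m xs ys z1s z2s
      = ((K₁ : ℝ) * (K₂ : ℝ))⁻¹ * enc m xs * auxBlk n (WY W) xs ys := by
  unfold codeJoint
  rw [← aux_blk_WY]
  simp_rw [Finset.mul_sum]

lemma aux_code_err {n K₁ K₂ s s' l₀ l₁ : ℕ} (e : Fin K₂ ≃ Fin s × Fin s')
    (hK₁ : 0 < K₁) (hK₂ : 0 < K₂)
    (W : X → Y × Z₁ × Z₂ → ℝ) (c : V → X → ℝ)
    (pU : U → ℝ) (k : U → (Fin n → V) → ℝ) (hs : AuxSrc pU k (auxBlk n (auxPU c (WY W))))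
    (γ₁ γ₂ : ℝ) (u : Fin s × Fin l₀ → U) (v : Fin s × Fin l₀ → Fin K₁ × Fin s' × Fin l₁ → Fin n → V) :
    ∃ dec : (Fin n → Y) → Fin K₁ × Fin K₂,
      errProb W (auxEnc n c (fun m (l : Fin l₀ × Fin l₁) =>
        v ((e m.2).1, l.1) (m.1, (e m.2).2, l.2))) dec ≤
      (Fintype.card ((Fin s × Fin l₀) × (Fin K₁ × Fin s' × Fin l₁)) : ℝ)⁻¹ *
        ∑ j : (Fin s × Fin l₀) × (Fin K₁ × Fin s' × Fin l₁), ∑ y,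
          auxBlk n (auxPU c (WY W)) (v j.1 j.2) y *
          auxBad pU k (auxBlk n (auxPU c (WY W))) γ₁ γ₂ u v j.1 j.2 y := by
  classical
  set TY := auxBlk n (auxPU c (WY W)) with hTY
  set vv : Fin K₁ × Fin K₂ → Fin l₀ × Fin l₁ → Fin n → V :=
    fun m l => v ((e m.2).1, l.1) (m.1, (e m.2).2, l.2) with hvv
  let t : (Fin s × Fin l₀) × (Fin K₁ × Fin s' × Fin l₁) → (Fin n → Y) → Prop := fun j z =>
    Real.exp γ₁ * auxP pU k TY z < TY (v j.1 j.2) z ∧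
        Real.exp γ₂ * auxPU k TY (u j.1) z < TY (v j.1 j.2) z
  let dec : (Fin n → Y) → Fin K₁ × Fin K₂ := fun ys =>
    if h : ∃ j, t j ys then ((auxPhi e).symm h.choose).1 else (⟨0, hK₁⟩, ⟨0, hK₂⟩)
  refine ⟨dec, ?_⟩
  have hcard : (Fintype.card ((Fin s × Fin l₀) × (Fin K₁ × Fin s' × Fin l₁)) : ℝ)
      = ((K₁ : ℝ) * K₂) * Fintype.card (Fin l₀ × Fin l₁) := by
    rw [← Fintype.card_congr (auxPhi (K₁ := K₁) (l₀ := l₀) (l₁ := l₁) e)]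
    simp
  have hbad : ∀ (m : Fin K₁ × Fin K₂) (l : Fin l₀ × Fin l₁) ys, dec ys ≠ m →
      1 ≤ auxBad pU k TY γ₁ γ₂ u v ((e m.2).1, l.1) (m.1, (e m.2).2, l.2) ys := by
    intro m l ys hne
    apply auxBad_ge_one
    intro ht
    have hex : ∃ j, t j ys := ⟨(((e m.2).1, l.1), (m.1, (e m.2).2, l.2)), ht⟩
    have hd : dec ys = ((auxPhi e).symm hex.choose).1 := by
      simp only [dec]; rw [dif_pos hex]
    refine ⟨hex.choose.1, hex.choose.2, ?_, hex.choose_spec⟩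
    by_contra hcon
    push Not at hcon
    apply hne
    rw [hd]
    have : hex.choose = auxPhi e (m, l) := Prod.ext hcon.1 hcon.2
    rw [this, Equiv.symm_apply_apply]
  unfold errProb
  have h1 : ∀ m, ∑ xs, ∑ ys, ∑ z1s, ∑ z2s,
      (if dec ys ≠ m then codeJoint W (auxEnc n c vv) m xs ys z1s z2s else 0)
      = ∑ ys, if dec ys ≠ m then ((K₁ : ℝ) * (K₂ : ℝ))⁻¹ *
        ((Fintype.card (Fin l₀ × Fin l₁) : ℝ)⁻¹ * ∑ l, TY (vv m l) ys) else 0 := by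
    intro m
    rw [Finset.sum_comm]
    refine Finset.sum_congr rfl fun ys _ => ?_
    split_ifs with h
    · simp_rw [aux_sumsY]
      exact aux_enc_out n c vv m (WY W) _ ys
    · simp
  simp_rw [h1]
  have hsum : ∀ G : (Fin s × Fin l₀) × (Fin K₁ × Fin s' × Fin l₁) → ℝ,
      ∑ j, G j = ∑ m, ∑ l, G (auxPhi e (m, l)) := by
    intro G
    rw [← (auxPhi e).sum_comp]
    exact Fintype.sum_prod_type _
  rw [hsum, hcard, mul_inv ((K₁ : ℝ) * K₂), Finset.mul_sum]
  refine Finset.sum_le_sum fun m _ => ?_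
  have h2 : ∀ ys, (if dec ys ≠ m then ((K₁ : ℝ) * (K₂ : ℝ))⁻¹ *
        ((Fintype.card (Fin l₀ × Fin l₁) : ℝ)⁻¹ * ∑ l, TY (vv m l) ys) else 0)
      ≤ ((K₁ : ℝ) * (K₂ : ℝ))⁻¹ * (Fintype.card (Fin l₀ × Fin l₁) : ℝ)⁻¹ * ∑ l, TY (vv m l) ys *
        auxBad pU k TY γ₁ γ₂ u v ((e m.2).1, l.1) (m.1, (e m.2).2, l.2) ys := by
    intro ys
    split_ifs with h
    · rw [mul_assoc]
      refine mul_le_mul_of_nonneg_left (mul_le_mul_of_nonneg_left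
        (Finset.sum_le_sum fun l _ => ?_) (by positivity)) (by positivity)
      exact le_mul_of_one_le_right (hs.T0 _ _) (hbad m l ys h)
    · refine mul_nonneg (by positivity) (Finset.sum_nonneg fun l _ => ?_)
      exact mul_nonneg (hs.T0 _ _) (auxBad_nonneg _ _ _ _ _ _ _ _ _ _)
  refine (Finset.sum_le_sum fun ys _ => h2 ys).trans ?_
  rw [← Finset.mul_sum, Finset.sum_comm]
  rfl

lemma aux_code_leak2 {n K₁ K₂ s s' l₀ l₁ : ℕ} (e : Fin K₂ ≃ Fin s × Fin s')
    (hK₁ : 0 < K₁) (hK₂ : 0 < K₂) (hl₀ : 0 < l₀) (hl₁ : 0 < l₁)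
    (W : X → Y × Z₁ × Z₂ → ℝ) (c : V → X → ℝ)
    (pU : U → ℝ) (k : U → (Fin n → V) → ℝ) (hs : AuxSrc pU k (auxBlk n (auxPU c (WZ2 W))))
    (u : Fin s × Fin l₀ → U) (v : Fin s × Fin l₀ → Fin K₁ × Fin s' × Fin l₁ → Fin n → V)
    (hsupp : ∀ a b, pU (u a) ≠ 0 ∧ k (u a) (v a b) ≠ 0) :
    leakMZ2 W (auxEnc n c (fun m (l : Fin l₀ × Fin l₁) =>
        v ((e m.2).1, l.1) (m.1, (e m.2).2, l.2))) * Real.log 2 ≤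
      (Fintype.card (Fin K₁ × Fin s × Fin s') : ℝ)⁻¹ * ∑ j : Fin K₁ × Fin s × Fin s',
        auxKL (fun z => (Fintype.card (Fin l₀ × Fin l₁) : ℝ)⁻¹ *
          ∑ l : Fin l₀ × Fin l₁, auxBlk n (auxPU c (WZ2 W)) (v (j.2.1, l.1) (j.1, j.2.2, l.2)) z)
          (auxP pU k (auxBlk n (auxPU c (WZ2 W)))) := by
  classical
  set T := auxBlk n (auxPU c (WZ2 W)) with hT
  set vv : Fin K₁ × Fin K₂ → Fin l₀ × Fin l₁ → Fin n → V :=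
    fun m l => v ((e m.2).1, l.1) (m.1, (e m.2).2, l.2) with hvv
  have : Nonempty (Fin K₁) := ⟨⟨0, hK₁⟩⟩
  have : Nonempty (Fin K₂) := ⟨⟨0, hK₂⟩⟩
  have : Nonempty (Fin l₀) := ⟨⟨0, hl₀⟩⟩
  have : Nonempty (Fin l₁) := ⟨⟨0, hl₁⟩⟩
  have key := aux_mutInfo_le (fun q : (Fin K₁ × Fin K₂) × (Fin n → Z₂) =>
    ∑ xs, ∑ ys, ∑ z1s, codeJoint W (auxEnc n c vv) q.1 xs ys z1s q.2)
    (fun m z => (Fintype.card (Fin l₀ × Fin l₁) : ℝ)⁻¹ * ∑ l, T (vv m l) z)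
    (by
      intro m z
      have : ∀ xs, ∑ ys, ∑ z1s, codeJoint W (auxEnc n c vv) m xs ys z1s z
          = ((K₁ : ℝ) * (K₂ : ℝ))⁻¹ * auxEnc n c vv m xs * auxBlk n (WZ2 W) xs z := by
        intro xs
        unfold codeJoint
        rw [← aux_blk_WZ2]
        simp_rw [Finset.mul_sum]
      simp_rw [this]
      rw [aux_enc_out]
      simp [hT])
    (auxP pU k T) (fun m z => aux_mix_nonneg _ (fun l z => hs.T0 _ z) z)
    (fun m => aux_mix_sum _ (fun l => hs.T1 _)) hs.P0 hs.P1
    (by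
      intro m z hz
      refine mul_eq_zero_of_right _ (Finset.sum_eq_zero fun l _ => ?_)
      by_contra hne
      have h := hsupp ((e m.2).1, l.1) (m.1, (e m.2).2, l.2)
      exact (hs.P_pos h.1 h.2 hne).ne' hz)
  unfold leakMZ2
  refine key.trans (le_of_eq ?_)
  rw [Fintype.card_congr (Equiv.prodCongr (Equiv.refl (Fin K₁)) e)]
  rw [← (Equiv.prodCongr (Equiv.refl (Fin K₁)) e).sum_comp]
  rfl

lemma aux_code_leak1 {n K₁ K₂ s s' l₀ l₁ : ℕ} (e : Fin K₂ ≃ Fin s × Fin s')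
    (hK₁ : 0 < K₁) (hss : 0 < s) (hs' : 0 < s') (hl₀ : 0 < l₀) (hl₁ : 0 < l₁)
    (W : X → Y × Z₁ × Z₂ → ℝ) (c : V → X → ℝ)
    (pU : U → ℝ) (k : U → (Fin n → V) → ℝ) (hs : AuxSrc pU k (auxBlk n (auxPU c (WZ1 W))))
    (u : Fin s × Fin l₀ → U) (v : Fin s × Fin l₀ → Fin K₁ × Fin s' × Fin l₁ → Fin n → V)
    (hsupp : ∀ a b, pU (u a) ≠ 0 ∧ k (u a) (v a b) ≠ 0) :
    leakM1Z1 W (auxEnc n c (fun m (l : Fin l₀ × Fin l₁) =>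
        v ((e m.2).1, l.1) (m.1, (e m.2).2, l.2))) * Real.log 2 ≤
      (Fintype.card (Fin K₁ × Fin s × Fin l₀) : ℝ)⁻¹ * ∑ j : Fin K₁ × Fin s × Fin l₀,
        auxKL (fun z => (Fintype.card (Fin s' × Fin l₁) : ℝ)⁻¹ *
          ∑ b : Fin s' × Fin l₁, auxBlk n (auxPU c (WZ1 W)) (v j.2 (j.1, b)) z)
          (auxPU k (auxBlk n (auxPU c (WZ1 W))) (u j.2)) := by
  classical
  set T := auxBlk n (auxPU c (WZ1 W)) with hT
  set vv : Fin K₁ × Fin K₂ → Fin l₀ × Fin l₁ → Fin n → V :=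
    fun m l => v ((e m.2).1, l.1) (m.1, (e m.2).2, l.2) with hvv
  have : Nonempty (Fin K₁) := ⟨⟨0, hK₁⟩⟩
  have : Nonempty (Fin s) := ⟨⟨0, hss⟩⟩
  have : Nonempty (Fin s') := ⟨⟨0, hs'⟩⟩
  have : Nonempty (Fin l₀) := ⟨⟨0, hl₀⟩⟩
  have : Nonempty (Fin l₁) := ⟨⟨0, hl₁⟩⟩
  have hK₂ : K₂ = s * s' := by simpa using Fintype.card_congr e
  set P : Fin K₁ → (Fin s × Fin l₀) → (Fin n → Z₁) → ℝ := fun m a z =>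
    (Fintype.card (Fin s' × Fin l₁) : ℝ)⁻¹ * ∑ b : Fin s' × Fin l₁, T (v a (m, b)) z with hP
  have hP0 : ∀ m a z, 0 ≤ P m a z := fun m a z => aux_mix_nonneg _ (fun l z => hs.T0 _ z) z
  have hP1 : ∀ m a, ∑ z, P m a z = 1 := fun m a => aux_mix_sum _ (fun l => hs.T1 _)
  have hPQ : ∀ m a z, auxPU k T (u a) z = 0 → P m a z = 0 := by
    intro m a z hz
    refine mul_eq_zero_of_right _ (Finset.sum_eq_zero fun l _ => ?_)
    by_contra hne
    exact (hs.PU_pos (hsupp a (m, l)).2 hne).ne' hz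
  have hcA : (0 : ℝ) < Fintype.card (Fin s × Fin l₀) := by exact_mod_cast Fintype.card_pos
  have key := aux_mutInfo_le (fun q : Fin K₁ × (Fin n → Z₁) =>
    ∑ m₂, ∑ xs, ∑ ys, ∑ z2s, codeJoint W (auxEnc n c vv) (q.1, m₂) xs ys q.2 z2s)
    (fun m z => (Fintype.card (Fin s × Fin l₀) : ℝ)⁻¹ * ∑ a, P m a z)
    (by
      intro m z
      have : ∀ m₂ xs, ∑ ys, ∑ z2s, codeJoint W (auxEnc n c vv) (m, m₂) xs ys z z2s
          = ((K₁ : ℝ) * (K₂ : ℝ))⁻¹ * auxEnc n c vv (m, m₂) xs * auxBlk n (WZ1 W) xs z := by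
        intro m₂ xs
        unfold codeJoint
        rw [← aux_blk_WZ1]
        simp_rw [Finset.mul_sum]
      simp_rw [this, aux_enc_out]
      simp only [hP]
      rw [← Finset.mul_sum, ← Finset.mul_sum, ← Finset.mul_sum]
      rw [← e.symm.sum_comp]
      simp only [Fintype.sum_prod_type, hvv, Equiv.apply_symm_apply, hK₂, Fintype.card_prod,
        Fintype.card_fin]
      have hc : ∀ i : Fin s, ∑ x : Fin s', ∑ x_1 : Fin l₀, ∑ x_2 : Fin l₁,
          T (v (i, x_1) (m, x, x_2)) z = ∑ x_1 : Fin l₀, ∑ x : Fin s', ∑ x_2 : Fin l₁,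
          T (v (i, x_1) (m, x, x_2)) z := fun i => Finset.sum_comm
      rw [← hT]
      simp_rw [hc]
      push_cast
      have q1 : (0:ℝ) < s := by exact_mod_cast hss
      have q2 : (0:ℝ) < s' := by exact_mod_cast hs'
      have q3 : (0:ℝ) < l₀ := by exact_mod_cast hl₀
      have q4 : (0:ℝ) < l₁ := by exact_mod_cast hl₁
      have q5 : (0:ℝ) < K₁ := by exact_mod_cast hK₁
      field_simp)
    (fun z => (Fintype.card (Fin s × Fin l₀) : ℝ)⁻¹ * ∑ a, auxPU k T (u a) z)
    (fun m z => aux_mix_nonneg _ (hP0 m) z)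
    (fun m => aux_mix_sum _ (hP1 m))
    (fun z => aux_mix_nonneg _ (fun a z => hs.PU0 (u a) z) z)
    (aux_mix_sum _ (fun a => hs.PU1 (u a)))
    (by
      intro m z hz
      have h0 : ∑ a, auxPU k T (u a) z = 0 := by
        rcases mul_eq_zero.1 hz with h | h
        · exact absurd h (inv_ne_zero hcA.ne')
        · exact h
      rw [Finset.sum_eq_zero_iff_of_nonneg (fun a _ => hs.PU0 (u a) z)] at h0
      exact mul_eq_zero_of_right _ (Finset.sum_eq_zero fun a _ =>
        hPQ m a z (h0 a (Finset.mem_univ a))))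
  unfold leakM1Z1
  refine key.trans ?_
  have h2 : ∀ m, auxKL (fun z => (Fintype.card (Fin s × Fin l₀) : ℝ)⁻¹ * ∑ a, P m a z)
      (fun z => (Fintype.card (Fin s × Fin l₀) : ℝ)⁻¹ * ∑ a, auxPU k T (u a) z)
      ≤ (Fintype.card (Fin s × Fin l₀) : ℝ)⁻¹ * ∑ a, auxKL (P m a) (auxPU k T (u a)) :=
    fun m => auxKL_convex (P m) (fun a => auxPU k T (u a)) (hP0 m) (fun a z => hs.PU0 _ z) (hPQ m)
  refine (mul_le_mul_of_nonneg_left (Finset.sum_le_sum fun m _ => h2 m) (by positivity)).trans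
    (le_of_eq ?_)
  rw [← Finset.mul_sum, Fintype.sum_prod_type, Fintype.card_prod (Fin K₁), Nat.cast_mul, mul_inv,
    mul_assoc]

lemma aux_enc_channel {M L : Type} [Fintype L] [Nonempty L] (n : ℕ) (c : V → X → ℝ)
    (hc : IsChannel c) (vv : M → L → Fin n → V) : IsChannel (auxEnc n c vv) := by
  intro m
  refine ⟨fun xs => ?_, ?_⟩
  · exact aux_mix_nonneg (fun l xs => auxBlk n c (vv m l) xs)
      (fun l xs => Finset.prod_nonneg fun i _ => (hc _).1 _) xs
  · exact aux_mix_sum (fun l xs => auxBlk n c (vv m l) xs) (fun l => auxBlk_sum n c (fun v => (hc v).2) _)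

end


section
variable {U V Z : Type} [Fintype U] [Fintype V] [Fintype Z]
    {pU : U → ℝ} {k : U → V → ℝ} {T : V → Z → ℝ}

lemma AuxSrc.momTP (h : AuxSrc pU k T) :
    ∃ C : ℝ, 0 ≤ C ∧ ∀ n : ℕ, 0 < n →
      auxE3 (auxPB n pU) (auxBlk n k) (auxBlk n T) (fun _ v z =>
        |Real.log (auxBlk n T v z / auxP (auxPB n pU) (auxBlk n k) (auxBlk n T) z)
          - n * auxE3 pU k T (fun _ v z => Real.log (T v z / auxP pU k T z))|) ≤ C * √n := by
  obtain ⟨C, hC, hm⟩ := h.moment (fun _ v z => T v z / auxP pU k T z)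
    (fun u v z h1 h2 h3 => div_ne_zero h3 (h.P_pos h1 h2 h3).ne')
  refine ⟨C, hC, fun n hn => ?_⟩
  have := hm n hn
  simpa only [auxP_blk, Finset.prod_div_distrib, auxBlk] using this

lemma AuxSrc.momTPU (h : AuxSrc pU k T) :
    ∃ C : ℝ, 0 ≤ C ∧ ∀ n : ℕ, 0 < n →
      auxE3 (auxPB n pU) (auxBlk n k) (auxBlk n T) (fun u v z =>
        |Real.log (auxBlk n T v z / auxPU (auxBlk n k) (auxBlk n T) u z)
          - n * auxE3 pU k T (fun u v z => Real.log (T v z / auxPU k T u z))|) ≤ C * √n := by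
  obtain ⟨C, hC, hm⟩ := h.moment (fun u v z => T v z / auxPU k T u z)
    (fun u v z h1 h2 h3 => div_ne_zero h3 (h.PU_pos h2 h3).ne')
  refine ⟨C, hC, fun n hn => ?_⟩
  have := hm n hn
  simpa only [auxPU_blk, Finset.prod_div_distrib, auxBlk] using this

lemma AuxSrc.momPUP (h : AuxSrc pU k T) :
    ∃ C : ℝ, 0 ≤ C ∧ ∀ n : ℕ, 0 < n →
      auxE3 (auxPB n pU) (auxBlk n k) (auxBlk n T) (fun u _ z =>
        |Real.log (auxPU (auxBlk n k) (auxBlk n T) u z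
            / auxP (auxPB n pU) (auxBlk n k) (auxBlk n T) z)
          - n * auxE3 pU k T (fun u _ z => Real.log (auxPU k T u z / auxP pU k T z))|)
          ≤ C * √n := by
  obtain ⟨C, hC, hm⟩ := h.moment (fun u _ z => auxPU k T u z / auxP pU k T z)
    (fun u v z h1 h2 h3 => div_ne_zero (h.PU_pos h2 h3).ne' (h.P_pos h1 h2 h3).ne')
  refine ⟨C, hC, fun n hn => ?_⟩
  have := hm n hn
  simpa only [auxPU_blk, auxP_blk, Finset.prod_div_distrib, auxBlk] using this

end

lemma aux_ceil (x : ℝ) (hx : 0 ≤ x) :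
    ∃ N : ℕ, 0 < N ∧ x ≤ Real.log N ∧ (N : ℝ) ≤ 2 * Real.exp x := by
  have h1 : 1 ≤ Real.exp x := Real.one_le_exp hx
  have h2 := Nat.le_ceil (Real.exp x)
  have h3 := Nat.ceil_lt_add_one (Real.exp_pos x).le
  have h4 : 0 < ⌈Real.exp x⌉₊ := Nat.ceil_pos.2 (Real.exp_pos x)
  refine ⟨⌈Real.exp x⌉₊, h4, ?_, by linarith⟩
  rw [Real.le_log_iff_exp_le (by exact_mod_cast h4)]
  exact h2

lemma aux_asymp (C₁ C₂ C₃ δ ε η : ℝ) (hC₁ : 0 ≤ C₁) (hC₂ : 0 ≤ C₂) (hC₃ : 0 ≤ C₃) (hδ : 0 < δ)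
    (hε : 0 < ε) (hη : 0 < η) :
    ∃ n : ℕ, 0 < n ∧ C₁ * √n * (n * δ)⁻¹ + 40 * Real.exp (-(n * δ)) ≤ ε ∧
      2 + C₂ * √n ≤ n * η ∧ 2 + C₃ * √n ≤ n * η := by
  set t : ℝ := max 1 (max ((C₁ + 40) / (δ * ε)) (max ((2 + C₂) / η) ((2 + C₃) / η))) with ht
  have t1 : 1 ≤ t := le_max_left _ _
  have t2 : (C₁ + 40) / (δ * ε) ≤ t := (le_max_left _ _).trans (le_max_right _ _)
  have t3 : (2 + C₂) / η ≤ t :=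
    (le_max_left _ _).trans ((le_max_right _ _).trans (le_max_right _ _))
  have t4 : (2 + C₃) / η ≤ t :=
    (le_max_right _ _).trans ((le_max_right _ _).trans (le_max_right _ _))
  rw [div_le_iff₀ (by positivity)] at t2 t3 t4
  refine ⟨⌈t ^ 2⌉₊, Nat.ceil_pos.2 (by positivity), ?_⟩
  set n := ⌈t ^ 2⌉₊ with hn
  set s : ℝ := √n with hs
  have hst : t ≤ s := Real.le_sqrt_of_sq_le (Nat.le_ceil _)
  have hs1 : 1 ≤ s := t1.trans hst
  have hss : s * s = n := Real.mul_self_sqrt (Nat.cast_nonneg _)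
  rw [← hss]
  refine ⟨?_, ?_, ?_⟩
  · have hpos : 0 < s * s * δ := by positivity
    have he : Real.exp (-(s * s * δ)) ≤ (s * s * δ)⁻¹ := by
      rw [Real.exp_neg]
      apply inv_anti₀ hpos
      linarith [Real.add_one_le_exp (s * s * δ)]
    have h40 : 40 * (s * s * δ)⁻¹ ≤ 40 * s * (s * s * δ)⁻¹ :=
      mul_le_mul_of_nonneg_right (by linarith) (by positivity)
    have hfin : (C₁ + 40) * s * (s * s * δ)⁻¹ ≤ ε := by
      rw [← div_eq_mul_inv, div_le_iff₀ hpos]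
      have : C₁ + 40 ≤ s * (δ * ε) := t2.trans (by gcongr)
      nlinarith
    linarith
  · have : 2 + C₂ ≤ s * η := t3.trans (by gcongr)
    nlinarith
  · have : 2 + C₃ ≤ s * η := t4.trans (by gcongr)
    nlinarith

section
variable {X Y Z₁ Z₂ V U : Type} [Fintype X] [Fintype Y] [Fintype Z₁] [Fintype Z₂] [Fintype V]
  [Fintype U]

lemma aux_achieve (W : X → Y × Z₁ × Z₂ → ℝ) (c : V → X → ℝ) (hc : IsChannel c)
    (pU : U → ℝ) (k : U → V → ℝ)
    (hY : AuxSrc pU k (auxPU c (WY W))) (h₁ : AuxSrc pU k (auxPU c (WZ1 W)))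
    (h₂ : AuxSrc pU k (auxPU c (WZ2 W))) (a a₂ b b₁ b₂ : ℝ)
    (hab : auxE3 pU k (auxPU c (WY W)) (fun _ v z => Real.log (auxPU c (WY W) v z /
      auxP pU k (auxPU c (WY W)) z)) = a + b)
    (hb : auxE3 pU k (auxPU c (WY W)) (fun u v z => Real.log (auxPU c (WY W) v z /
      auxPU k (auxPU c (WY W)) u z)) = b)
    (hb₁ : auxE3 pU k (auxPU c (WZ1 W)) (fun u v z => Real.log (auxPU c (WZ1 W) v z /
      auxPU k (auxPU c (WZ1 W)) u z)) = b₁)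
    (ha₂ : auxE3 pU k (auxPU c (WZ2 W)) (fun u _ z => Real.log (auxPU k (auxPU c (WZ2 W)) u z /
      auxP pU k (auxPU c (WZ2 W)) z)) = a₂)
    (hab₂ : auxE3 pU k (auxPU c (WZ2 W)) (fun _ v z => Real.log (auxPU c (WZ2 W) v z /
      auxP pU k (auxPU c (WZ2 W)) z)) = a₂ + b₂)
    (i1 : 0 ≤ a₂) (i2 : a₂ ≤ a) (i3 : 0 ≤ b₂) (i4 : b₂ ≤ b₁) (i5 : b₁ < b) :
    Achievable W ((b - b₁) / Real.log 2) ((a - a₂ + b₁ - b₂) / Real.log 2) := by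
  intro ε hε
  have hl2 : 0 < Real.log 2 := Real.log_pos (by norm_num)
  set δ := min (ε * Real.log 2) ((b - b₁) / 2) with hδd
  have hδ : 0 < δ := lt_min (by positivity) (by linarith)
  have hδ1 : δ ≤ ε * Real.log 2 := min_le_left _ _
  have hδ2 : δ ≤ (b - b₁) / 2 := min_le_right _ _
  obtain ⟨C1, hC1, m1⟩ := hY.momTP
  obtain ⟨C2, hC2, m2⟩ := hY.momTPU
  obtain ⟨C3, hC3, m3⟩ := h₂.momPUP
  obtain ⟨C4, hC4, m4⟩ := h₂.momTP
  obtain ⟨C5, hC5, m5⟩ := h₁.momTPU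
  obtain ⟨n, hn, q1, q2, q3⟩ := aux_asymp (C1 + C2) (C3 + C4) C5 (δ / 2) (ε / 3)
    (ε * Real.log 2 / 3) (by positivity) (by positivity) hC5 (by positivity) (by positivity)
    (by positivity)
  have hn0 : (0 : ℝ) < n := by exact_mod_cast hn
  have m1 := m1 n hn
  have m2 := m2 n hn
  have m3 := m3 n hn
  have m4 := m4 n hn
  have m5 := m5 n hn
  rw [hab] at m1
  rw [hb] at m2
  rw [ha₂] at m3
  rw [hab₂] at m4
  rw [hb₁] at m5
  obtain ⟨l₀, l₀p, l₀g, l₀l⟩ := aux_ceil (n * a₂) (by positivity)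
  obtain ⟨s, sp, sg, sl⟩ := aux_ceil (n * (a - a₂)) (mul_nonneg hn0.le (by linarith))
  obtain ⟨s', sp', sg', sl'⟩ := aux_ceil (n * (b₁ - b₂)) (mul_nonneg hn0.le (by linarith))
  obtain ⟨l₁, l₁p, l₁g, l₁l⟩ := aux_ceil (n * b₂) (by positivity)
  obtain ⟨K₁, K₁p, K₁g, K₁l⟩ := aux_ceil (n * (b - b₁ - δ)) (mul_nonneg hn0.le (by linarith))
  have rl₀ : (0:ℝ) < l₀ := by exact_mod_cast l₀p
  have rs : (0:ℝ) < s := by exact_mod_cast sp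
  have rs' : (0:ℝ) < s' := by exact_mod_cast sp'
  have rl₁ : (0:ℝ) < l₁ := by exact_mod_cast l₁p
  have rK₁ : (0:ℝ) < K₁ := by exact_mod_cast K₁p
  have : Nonempty (Fin l₀) := ⟨⟨0, l₀p⟩⟩
  have : Nonempty (Fin s) := ⟨⟨0, sp⟩⟩
  have : Nonempty (Fin s') := ⟨⟨0, sp'⟩⟩
  have : Nonempty (Fin l₁) := ⟨⟨0, l₁p⟩⟩
  have : Nonempty (Fin K₁) := ⟨⟨0, K₁p⟩⟩
  set γ₁ : ℝ := n * (a + b - δ / 2) with hγ₁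
  set γ₂ : ℝ := n * (b - δ / 2) with hγ₂
  have d1 : n * (a + b) - γ₁ = n * (δ / 2) := by rw [hγ₁]; ring
  have d2 : n * b - γ₂ = n * (δ / 2) := by rw [hγ₂]; ring
  have hdp : 0 < n * (δ / 2) := by positivity
  have cB : (Fintype.card (Fin K₁ × Fin s' × Fin l₁) : ℝ) ≤ 8 * Real.exp (n * (b - δ)) := by
    simp only [Fintype.card_prod, Fintype.card_fin]
    push_cast
    calc (K₁ : ℝ) * (s' * l₁) ≤ (2 * Real.exp (n * (b - b₁ - δ))) * ((2 * Real.exp (n * (b₁ - b₂)))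
          * (2 * Real.exp (n * b₂))) := by gcongr
      _ = 8 * (Real.exp (n * (b - b₁ - δ)) * (Real.exp (n * (b₁ - b₂)) * Real.exp (n * b₂))) := by
          ring
      _ = _ := by rw [← Real.exp_add, ← Real.exp_add]; ring_nf
  have cA : (Fintype.card (Fin s × Fin l₀) : ℝ) ≤ 4 * Real.exp (n * a) := by
    simp only [Fintype.card_prod, Fintype.card_fin]
    push_cast
    calc (s : ℝ) * l₀ ≤ (2 * Real.exp (n * (a - a₂))) * (2 * Real.exp (n * a₂)) := by gcongr
      _ = 4 * (Real.exp (n * (a - a₂)) * Real.exp (n * a₂)) := by ring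
      _ = _ := by rw [← Real.exp_add]; ring_nf
  have t1 : (Fintype.card (Fin s × Fin l₀) : ℝ) * Fintype.card (Fin K₁ × Fin s' × Fin l₁)
      * Real.exp (-γ₁) ≤ 32 * Real.exp (-(n * (δ / 2))) := by
    calc _ ≤ (4 * Real.exp (n * a)) * (8 * Real.exp (n * (b - δ))) * Real.exp (-γ₁) := by gcongr
      _ = 32 * (Real.exp (n * a) * Real.exp (n * (b - δ)) * Real.exp (-γ₁)) := by ring
      _ = _ := by rw [← Real.exp_add, ← Real.exp_add, hγ₁]; ring_nf
  have t2 : (Fintype.card (Fin K₁ × Fin s' × Fin l₁) : ℝ)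
      * Real.exp (-γ₂) ≤ 8 * Real.exp (-(n * (δ / 2))) := by
    calc _ ≤ (8 * Real.exp (n * (b - δ))) * Real.exp (-γ₂) := by gcongr
      _ = 8 * (Real.exp (n * (b - δ)) * Real.exp (-γ₂)) := by ring
      _ = _ := by rw [← Real.exp_add, hγ₂]; ring_nf
  have hlog4 : Real.log 4 ≤ 2 := by
    have : Real.log 4 = 2 * Real.log 2 := by
      rw [show (4:ℝ) = 2 ^ 2 by norm_num, Real.log_pow]; norm_num
    linarith [Real.log_two_lt_d9]
  have hlog2 : Real.log 2 ≤ 2 := by linarith [Real.log_two_lt_d9]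
  obtain ⟨u, v, hsupp, r1, r2, r3⟩ := aux_oneshot (S := Fin s) (L₀ := Fin l₀) (M₁ := Fin K₁)
    (S' := Fin s') (L₁ := Fin l₁) (auxPB n pU) (auxBlk n k) (auxBlk n (auxPU c (WY W)))
    (auxBlk n (auxPU c (WZ1 W))) (auxBlk n (auxPU c (WZ2 W))) (hY.blk n) (h₁.blk n) (h₂.blk n)
    γ₁ γ₂ (n * (a + b)) (n * b) (n * a₂) (n * (a₂ + b₂)) (n * b₁)
    (by linarith) (by linarith)
    (by simpa using l₀g)
    (by
      simp only [Fintype.card_fin]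
      rw [Real.log_mul rl₀.ne' rl₁.ne']; linarith)
    (by
      simp only [Fintype.card_prod, Fintype.card_fin]
      push_cast
      rw [Real.log_mul rs'.ne' rl₁.ne']; linarith)
    (ε / 3) (n * (ε * Real.log 2 / 3)) (n * (ε * Real.log 2 / 3))
    (by positivity) (by positivity) (by positivity)
    (by
      rw [d1, d2]
      have hi : 0 ≤ (n * (δ / 2))⁻¹ := by positivity
      have e1 := mul_le_mul_of_nonneg_right m1 hi
      have e2 := mul_le_mul_of_nonneg_right m2 hi
      linarith)
    (by linarith)
    (by linarith)
  have e : Fin (s * s') ≃ Fin s × Fin s' := finProdFinEquiv.symm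
  have hK₂ : 0 < s * s' := Nat.mul_pos sp sp'
  obtain ⟨dec, hdec⟩ := aux_code_err e K₁p hK₂ W c (auxPB n pU) (auxBlk n k) (hY.blk n) γ₁ γ₂ u v
  refine ⟨n, hn, K₁, s * s', K₁p, hK₂, ?_, ?_, _, aux_enc_channel n c hc _, dec,
    hdec.trans (by linarith), ?_, ?_⟩
  · unfold Real.logb
    rw [le_div_iff₀ hl2]
    have : n * ((b - b₁) / Real.log 2 - ε) * Real.log 2 = n * (b - b₁ - ε * Real.log 2) := by
      field_simp
    rw [this]
    refine le_trans ?_ K₁g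
    gcongr
  · unfold Real.logb
    rw [le_div_iff₀ hl2]
    have : n * ((a - a₂ + b₁ - b₂) / Real.log 2 - ε) * Real.log 2
      = n * (a - a₂ + b₁ - b₂) - n * ε * Real.log 2 := by
      field_simp
    rw [this]
    push_cast
    rw [Real.log_mul rs.ne' rs'.ne']
    have : 0 ≤ n * ε * Real.log 2 := by positivity
    linarith
  · have := aux_code_leak2 e K₁p hK₂ l₀p l₁p W c (auxPB n pU) (auxBlk n k) (h₂.blk n) u v hsupp
    refine le_of_mul_le_mul_right (this.trans (r2.trans (le_of_eq ?_))) hl2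
    ring
  · have := aux_code_leak1 e K₁p sp sp' l₀p l₁p W c (auxPB n pU) (auxBlk n k) (h₁.blk n) u v hsupp
    refine le_of_mul_le_mul_right (this.trans (r3.trans (le_of_eq ?_))) hl2
    ring

end


lemma aux_kernel {A B : Type} [Fintype B] [Nonempty B] (p : A → B → ℝ) (hp : ∀ a b, 0 ≤ p a b) :
    ∃ k : A → B → ℝ, IsChannel k ∧ ∀ a b, p a b = (∑ b', p a b') * k a b := by
  classical
  let b₀ : B := Classical.arbitrary B
  refine ⟨fun a b => if (∑ b', p a b') = 0 then (if b = b₀ then 1 else 0)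
    else p a b / ∑ b', p a b', fun a => ⟨fun b => ?_, ?_⟩, fun a b => ?_⟩
  · dsimp only
    split_ifs
    · norm_num
    · norm_num
    · exact div_nonneg (hp a b) (Finset.sum_nonneg fun b _ => hp a b)
  · by_cases h : (∑ b', p a b') = 0
    · simp [h]
    · simp only [h, if_false]
      rw [← Finset.sum_div, div_self h]
  · by_cases h : (∑ b', p a b') = 0
    · have h2 := h
      rw [Finset.sum_eq_zero_iff_of_nonneg (fun b _ => hp a b)] at h2
      rw [h2 b (Finset.mem_univ b), h, zero_mul]
    · simp only [h, if_false]
      rw [mul_div_cancel₀ _ h]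

lemma aux_factor {U V X : Type} [Fintype U] [Fintype V] [Fintype X] (p : U × V × X → ℝ)
    (hp : IsPMF p)
    (hM : ∀ u v x, p (u, v, x) * (∑ u', ∑ x', p (u', v, x')) =
        (∑ x', p (u, v, x')) * (∑ u', p (u', v, x))) :
    ∃ (pU : U → ℝ) (k : U → V → ℝ) (c : V → X → ℝ), IsPMF pU ∧ IsChannel k ∧ IsChannel c ∧
      ∀ u v x, p (u, v, x) = pU u * k u v * c v x := by
  have hne : Nonempty (U × V × X) := by
    by_contra h
    rw [not_nonempty_iff] at h
    have := hp.2
    rw [Finset.univ_eq_empty, Finset.sum_empty] at this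
    norm_num at this
  obtain ⟨⟨u₀, v₀, x₀⟩⟩ := hne
  have : Nonempty V := ⟨v₀⟩
  have : Nonempty X := ⟨x₀⟩
  have h0 := hp.1
  obtain ⟨k, hk, hkf⟩ := aux_kernel (fun u v => ∑ x, p (u, v, x))
    (fun u v => Finset.sum_nonneg fun x _ => h0 _)
  obtain ⟨c, hc, hcf⟩ := aux_kernel (fun v x => ∑ u, p (u, v, x))
    (fun u v => Finset.sum_nonneg fun x _ => h0 _)
  refine ⟨fun u => ∑ v, ∑ x, p (u, v, x), k, c, ⟨fun u => Finset.sum_nonneg fun v _ =>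
    Finset.sum_nonneg fun x _ => h0 _, ?_⟩, hk, hc, fun u v x => ?_⟩
  · have := hp.2
    simp only [Fintype.sum_prod_type] at this
    exact this
  · rw [← hkf u v]
    have hcf' := hcf v x
    rw [Finset.sum_comm] at hcf'
    by_cases hz : (∑ u', ∑ x', p (u', v, x')) = 0
    · have h1 := hz
      rw [Finset.sum_eq_zero_iff_of_nonneg
        (fun u _ => Finset.sum_nonneg fun x _ => h0 _)] at h1
      have h2 := h1 u (Finset.mem_univ u)
      have h3 := h2
      rw [Finset.sum_eq_zero_iff_of_nonneg (fun x _ => h0 _)] at h3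
      rw [h2, h3 x (Finset.mem_univ x), zero_mul]
    · apply mul_right_cancel₀ hz
      rw [hM, hcf']
      ring

section
variable {U V X Z : Type} [Fintype U] [Fintype V] [Fintype X] [Fintype Z]
    {pU : U → ℝ} {k : U → V → ℝ} {T : V → Z → ℝ}

lemma AuxSrc.ofKernel {c : V → X → ℝ} {K : X → Z → ℝ} (hU : IsPMF pU) (hk : IsChannel k)
    (hc : IsChannel c) (hK : IsChannel K) : AuxSrc pU k (auxPU c K) where
  pU0 := hU.1
  pU1 := hU.2
  k0 := fun u => (hk u).1
  k1 := fun u => (hk u).2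
  T0 := fun v z => Finset.sum_nonneg fun x _ => mul_nonneg ((hc v).1 x) ((hK x).1 z)
  T1 := fun v => by
    unfold auxPU
    rw [Finset.sum_comm]
    simp_rw [← Finset.mul_sum, (hK _).2, mul_one, (hc v).2]

lemma AuxSrc.mi_U (h : AuxSrc pU k T) (J : U × Z → ℝ)
    (hJ : ∀ u z, J (u, z) = pU u * auxPU k T u z) :
    mutInfo J * Real.log 2 =
      auxE3 pU k T (fun u _ z => Real.log (auxPU k T u z / auxP pU k T z)) := by
  rw [aux_mutInfo_eq]
  have h1 : ∀ u, ∑ z, J (u, z) = pU u := fun u => by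
    simp_rw [hJ, ← Finset.mul_sum, h.PU1, mul_one]
  have h2 : ∀ z, ∑ u, J (u, z) = auxP pU k T z := fun z => by
    simp_rw [hJ]; rfl
  simp_rw [h1, h2, hJ]
  unfold auxE3
  refine Finset.sum_congr rfl fun u _ => ?_
  rw [Finset.sum_comm]
  refine Finset.sum_congr rfl fun z _ => ?_
  rw [← Finset.sum_mul]
  have h3 : ∑ v, pU u * k u v * T v z = pU u * auxPU k T u z := by
    unfold auxPU; simp_rw [Finset.mul_sum, mul_assoc]
  rw [h3]
  by_cases hu : pU u = 0
  · simp [hu]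
  · rw [mul_div_mul_left _ _ hu]

lemma AuxSrc.mi_V (h : AuxSrc pU k T) (J : V × Z → ℝ)
    (hJ : ∀ v z, J (v, z) = (∑ u, pU u * k u v) * T v z) :
    mutInfo J * Real.log 2 =
      auxE3 pU k T (fun _ v z => Real.log (T v z / auxP pU k T z)) := by
  rw [aux_mutInfo_eq]
  have h1 : ∀ v, ∑ z, J (v, z) = ∑ u, pU u * k u v := fun v => by
    simp_rw [hJ, ← Finset.mul_sum, h.T1, mul_one]
  have h2 : ∀ z, ∑ v, J (v, z) = auxP pU k T z := fun z => by
    simp_rw [hJ, Finset.sum_mul]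
    rw [Finset.sum_comm, AuxSrc.P_eq]
  simp_rw [h1, h2, hJ]
  unfold auxE3
  rw [Finset.sum_comm (s := (Finset.univ : Finset U))]
  refine Finset.sum_congr rfl fun v _ => ?_
  rw [Finset.sum_comm (s := (Finset.univ : Finset U))]
  refine Finset.sum_congr rfl fun z _ => ?_
  rw [← Finset.sum_mul, ← Finset.sum_mul]
  by_cases hu : ∑ u, pU u * k u v = 0
  · simp [hu]
  · rw [mul_div_mul_left _ _ hu]

lemma AuxSrc.mi_cond (h : AuxSrc pU k T) (J : V × Z × U → ℝ)
    (hJ : ∀ v z u, J (v, z, u) = pU u * k u v * T v z) :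
    condMutInfo J * Real.log 2 =
      auxE3 pU k T (fun u v z => Real.log (T v z / auxPU k T u z)) := by
  have hl : Real.log 2 ≠ 0 := (Real.log_pos (by norm_num)).ne'
  have h1 : ∀ u, ∑ v, ∑ z, J (v, z, u) = pU u := fun u => by
    simp_rw [hJ, ← Finset.mul_sum, h.T1, mul_one, ← Finset.mul_sum, h.k1, mul_one]
  have h2 : ∀ v u, ∑ z, J (v, z, u) = pU u * k u v := fun v u => by
    simp_rw [hJ, ← Finset.mul_sum, h.T1, mul_one]
  have h3 : ∀ z u, ∑ v, J (v, z, u) = pU u * auxPU k T u z := fun z u => by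
    unfold auxPU; simp_rw [hJ, Finset.mul_sum, mul_assoc]
  unfold condMutInfo auxE3
  simp only [Fintype.sum_prod_type]
  simp_rw [h1, h2, h3, hJ]
  rw [Finset.sum_comm (s := (Finset.univ : Finset U)), Finset.sum_mul]
  refine Finset.sum_congr rfl fun v _ => ?_
  rw [Finset.sum_comm (s := (Finset.univ : Finset U)), Finset.sum_mul]
  refine Finset.sum_congr rfl fun z _ => ?_
  rw [Finset.sum_mul]
  refine Finset.sum_congr rfl fun u _ => ?_
  unfold Real.logb
  by_cases hu : pU u = 0
  · simp [hu]
  by_cases hk : k u v = 0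
  · simp [hk]
  have : pU u * (pU u * k u v * T v z) / (pU u * k u v * (pU u * auxPU k T u z))
      = T v z / auxPU k T u z := by
    rw [show pU u * (pU u * k u v * T v z) = (pU u * pU u * k u v) * T v z by ring,
      show pU u * k u v * (pU u * auxPU k T u z) = (pU u * pU u * k u v) * auxPU k T u z by ring]
    exact mul_div_mul_left _ _ (by positivity)
  rw [this]
  field_simp

lemma AuxSrc.chain (h : AuxSrc pU k T) :
    auxE3 pU k T (fun _ v z => Real.log (T v z / auxP pU k T z))
      = auxE3 pU k T (fun u _ z => Real.log (auxPU k T u z / auxP pU k T z))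
       + auxE3 pU k T (fun u v z => Real.log (T v z / auxPU k T u z)) := by
  rw [← auxE3_add]
  refine h.E3_congr fun u v z h1 h2 h3 => ?_
  have p1 := (h.P_pos h1 h2 h3).ne'
  have p2 := (h.PU_pos h2 h3).ne'
  rw [Real.log_div h3 p1, Real.log_div p2 p1, Real.log_div h3 p2]
  ring

lemma AuxSrc.E3_KL (pU : U → ℝ) (k : U → V → ℝ) (T : V → Z → ℝ) :
    auxE3 pU k T (fun u v z => Real.log (T v z / auxPU k T u z))
      = ∑ u, ∑ v, pU u * k u v * auxKL (T v) (auxPU k T u) := by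
  unfold auxE3 auxKL
  simp_rw [Finset.mul_sum, mul_assoc]

lemma AuxSrc.b_nonneg (h : AuxSrc pU k T) :
    0 ≤ auxE3 pU k T (fun u v z => Real.log (T v z / auxPU k T u z)) := by
  rw [AuxSrc.E3_KL]
  refine Finset.sum_nonneg fun u _ => Finset.sum_nonneg fun v _ => ?_
  by_cases hk : k u v = 0
  · simp [hk]
  refine mul_nonneg (mul_nonneg (h.pU0 u) (h.k0 u v)) ?_
  refine auxKL_nonneg _ _ (h.T0 v) (h.PU0 u) (fun z hz => ?_) (h.T1 v) (h.PU1 u)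
  by_contra hT
  exact (h.PU_pos hk hT).ne' hz

lemma AuxSrc.a_nonneg (h : AuxSrc pU k T) :
    0 ≤ auxE3 pU k T (fun u _ z => Real.log (auxPU k T u z / auxP pU k T z)) := by
  have : auxE3 pU k T (fun u _ z => Real.log (auxPU k T u z / auxP pU k T z))
      = ∑ u, pU u * auxKL (auxPU k T u) (auxP pU k T) := by
    unfold auxE3 auxKL
    refine Finset.sum_congr rfl fun u _ => ?_
    rw [Finset.sum_comm, Finset.mul_sum]
    refine Finset.sum_congr rfl fun z _ => ?_
    rw [← Finset.sum_mul, ← mul_assoc]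
    congr 1
    change _ = pU u * ∑ v, k u v * T v z
    simp_rw [Finset.mul_sum, mul_assoc]
  rw [this]
  refine Finset.sum_nonneg fun u _ => ?_
  by_cases hu : pU u = 0
  · simp [hu]
  refine mul_nonneg (h.pU0 u) ?_
  refine auxKL_nonneg _ _ (h.PU0 u) h.P0 (fun z hz => ?_) (h.PU1 u) h.P1
  refine Finset.sum_eq_zero fun v _ => ?_
  by_contra hne
  exact (h.P_pos hu (left_ne_zero_of_mul hne) (right_ne_zero_of_mul hne)).ne' hz

lemma auxKL_dpi {Z₁ Z₂ : Type} [Fintype Z₁] [Fintype Z₂] (p r : Z₁ → ℝ) (q : Z₁ → Z₂ → ℝ)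
    (hq : IsChannel q) (hp : ∀ z, 0 ≤ p z) (hr : ∀ z, 0 ≤ r z) (hpr : ∀ z, r z = 0 → p z = 0) :
    auxKL (fun z₂ => ∑ z₁, p z₁ * q z₁ z₂) (fun z₂ => ∑ z₁, r z₁ * q z₁ z₂) ≤ auxKL p r := by
  unfold auxKL
  have h1 : ∀ z₂, (∑ z₁, p z₁ * q z₁ z₂) * Real.log ((∑ z₁, p z₁ * q z₁ z₂) /
      ∑ z₁, r z₁ * q z₁ z₂) ≤ ∑ z₁, p z₁ * Real.log (p z₁ / r z₁) * q z₁ z₂ := by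
    intro z₂
    refine (aux_logsum (fun z₁ => p z₁ * q z₁ z₂) (fun z₁ => r z₁ * q z₁ z₂)
      (fun z => mul_nonneg (hp z) ((hq z).1 z₂)) (fun z => mul_nonneg (hr z) ((hq z).1 z₂))
      (fun z hz => ?_)).trans (le_of_eq ?_)
    · rcases mul_eq_zero.1 hz with h | h
      · rw [hpr z h, zero_mul]
      · rw [h, mul_zero]
    · refine Finset.sum_congr rfl fun z _ => ?_
      by_cases h : q z z₂ = 0
      · simp [h]
      · rw [mul_div_mul_right _ _ h]; ring
  refine (Finset.sum_le_sum fun z _ => h1 z).trans (le_of_eq ?_)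
  rw [Finset.sum_comm]
  simp_rw [← Finset.mul_sum, (hq _).2, mul_one]

lemma AuxSrc.dpi {Z₁ Z₂ : Type} [Fintype Z₁] [Fintype Z₂] {T₁ : V → Z₁ → ℝ} {T₂ : V → Z₂ → ℝ}
    (h : AuxSrc pU k T₁) (q : Z₁ → Z₂ → ℝ) (hq : IsChannel q)
    (hT : ∀ v z₂, T₂ v z₂ = ∑ z₁, T₁ v z₁ * q z₁ z₂) :
    auxE3 pU k T₂ (fun u v z => Real.log (T₂ v z / auxPU k T₂ u z))
      ≤ auxE3 pU k T₁ (fun u v z => Real.log (T₁ v z / auxPU k T₁ u z)) := by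
  rw [AuxSrc.E3_KL, AuxSrc.E3_KL]
  refine Finset.sum_le_sum fun u _ => Finset.sum_le_sum fun v _ => ?_
  by_cases hk : k u v = 0
  · simp [hk]
  refine mul_le_mul_of_nonneg_left ?_ (mul_nonneg (h.pU0 u) (h.k0 u v))
  have e1 : T₂ v = fun z₂ => ∑ z₁, T₁ v z₁ * q z₁ z₂ := funext (hT v)
  have e2 : auxPU k T₂ u = fun z₂ => ∑ z₁, auxPU k T₁ u z₁ * q z₁ z₂ := by
    funext z₂
    unfold auxPU
    simp_rw [hT, Finset.mul_sum, Finset.sum_mul, mul_assoc]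
    rw [Finset.sum_comm]
  rw [e1, e2]
  refine auxKL_dpi _ _ q hq (h.T0 v) (h.PU0 u) fun z hz => ?_
  by_contra hne
  exact (h.PU_pos hk hne).ne' hz

/-- the three joint laws in factorized form -/
lemma aux_joint {c : V → X → ℝ} {K : X → Z → ℝ} (p : U × V × X → ℝ)
    (hf : ∀ u v x, p (u, v, x) = pU u * k u v * c v x) (u : U) (v : V) (z : Z) :
    ∑ x, p (u, v, x) * K x z = pU u * k u v * auxPU c K v z := by
  unfold auxPU
  simp_rw [hf, Finset.mul_sum, mul_assoc]

end

/-- a two-level security wiretap channel (with `X → Z₁ → Z₂`) is embeddable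
if there exist auxiliaries `U → V → X → (Y,Z₁,Z₂)` with `I(U;Y) ≥ I(U;Z₂)`, such that the
marginal `p(v,x)` is optimal for `max [I(V;Y) − I(V;Z₂)]` and `I(V;Y|U) − I(V;Z₁|U) > 0`. -/
theorem stmt2_embeddable_sufficient_condition
    (W : 𝒳 → 𝒴 × 𝒵₁ × 𝒵₂ → ℝ) (hW : IsChannel W) (hdeg : DegradedZ1Z2 W)
    {𝒰 𝒱 : Type} [Fintype 𝒰] [Fintype 𝒱]
    (pUVX : 𝒰 × 𝒱 × 𝒳 → ℝ) (hpUVX : IsPMF pUVX)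
    -- Markov chain U → V → X (so that U → V → X → (Y,Z₁,Z₂) holds for the memoryless channel)
    (hMarkov : ∀ u v x,
      pUVX (u, v, x) * (∑ u', ∑ x', pUVX (u', v, x')) =
        (∑ x', pUVX (u, v, x')) * (∑ u', pUVX (u', v, x)))
    -- I(U;Y) ≥ I(U;Z₂)
    (hUY : mutInfo (fun q : 𝒰 × 𝒴 => ∑ v, ∑ x, pUVX (q.1, v, x) * WY W x q.2) ≥
      mutInfo (fun q : 𝒰 × 𝒵₂ => ∑ v, ∑ x, pUVX (q.1, v, x) * WZ2 W x q.2))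
    -- the marginal p(v,x) is an optimal solution of max_{p(v,x)} [I(V;Y) − I(V;Z₂)]
    (hopt : mutInfo (fun q : 𝒱 × 𝒴 => ∑ u, ∑ x, pUVX (u, q.1, x) * WY W x q.2) -
        mutInfo (fun q : 𝒱 × 𝒵₂ => ∑ u, ∑ x, pUVX (u, q.1, x) * WZ2 W x q.2) =
      wiretapCapZ2 W)
    -- I(V;Y|U) − I(V;Z₁|U) > 0
    (hpos : 0 <
      condMutInfo (fun t : 𝒱 × 𝒴 × 𝒰 => ∑ x, pUVX (t.2.2, t.1, x) * WY W x t.2.1) -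
        condMutInfo (fun t : 𝒱 × 𝒵₁ × 𝒰 => ∑ x, pUVX (t.2.2, t.1, x) * WZ1 W x t.2.1)) :
    Embeddable W := by
  classical
  have hl2 : 0 < Real.log 2 := Real.log_pos (by norm_num)
  obtain ⟨pU, k, c, hU, hk, hc, hf⟩ := aux_factor pUVX hpUVX hMarkov
  obtain ⟨q, hq, hqW⟩ := hdeg
  have htot : ∀ x, ∑ y, ∑ z₁, ∑ z₂, W x (y, z₁, z₂) = 1 := by
    intro x
    have := (hW x).2
    simpa only [Fintype.sum_prod_type] using this
  have hWY : IsChannel (WY W) := fun x => ⟨fun y => Finset.sum_nonneg fun z₁ _ =>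
    Finset.sum_nonneg fun z₂ _ => (hW x).1 _, htot x⟩
  have hWZ1 : IsChannel (WZ1 W) := fun x => ⟨fun y => Finset.sum_nonneg fun z₁ _ =>
    Finset.sum_nonneg fun z₂ _ => (hW x).1 _, by
      unfold WZ1
      rw [Finset.sum_comm]
      exact htot x⟩
  have hWZ2 : IsChannel (WZ2 W) := fun x => ⟨fun y => Finset.sum_nonneg fun z₁ _ =>
    Finset.sum_nonneg fun z₂ _ => (hW x).1 _, by
      unfold WZ2
      rw [Finset.sum_comm, ← htot x]
      exact Finset.sum_congr rfl fun y _ => Finset.sum_comm⟩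
  have hdegW : ∀ x z₂, WZ2 W x z₂ = ∑ z₁, WZ1 W x z₁ * q z₁ z₂ := by
    intro x z₂
    unfold WZ2
    rw [Finset.sum_comm]
    exact Finset.sum_congr rfl fun z₁ _ => hqW x z₁ z₂
  have hY : AuxSrc pU k (auxPU c (WY W)) := AuxSrc.ofKernel hU hk hc hWY
  have h1 : AuxSrc pU k (auxPU c (WZ1 W)) := AuxSrc.ofKernel hU hk hc hWZ1
  have h2 : AuxSrc pU k (auxPU c (WZ2 W)) := AuxSrc.ofKernel hU hk hc hWZ2
  have jU : ∀ {Z : Type} [Fintype Z] (K : 𝒳 → Z → ℝ) (u : 𝒰) (z : Z),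
      ∑ v, ∑ x, pUVX (u, v, x) * K x z = pU u * auxPU k (auxPU c K) u z := by
    intro Z _ K u z
    simp_rw [aux_joint pUVX hf]
    change _ = pU u * ∑ v, k u v * auxPU c K v z
    simp_rw [Finset.mul_sum, mul_assoc]
  have jV : ∀ {Z : Type} [Fintype Z] (K : 𝒳 → Z → ℝ) (v : 𝒱) (z : Z),
      ∑ u, ∑ x, pUVX (u, v, x) * K x z = (∑ u, pU u * k u v) * auxPU c K v z := by
    intro Z _ K v z
    simp_rw [aux_joint pUVX hf, Finset.sum_mul]
  have eUY := hY.mi_U (fun q : 𝒰 × 𝒴 => ∑ v, ∑ x, pUVX (q.1, v, x) * WY W x q.2)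
    (fun u z => jU (WY W) u z)
  have eUZ := h2.mi_U (fun q : 𝒰 × 𝒵₂ => ∑ v, ∑ x, pUVX (q.1, v, x) * WZ2 W x q.2)
    (fun u z => jU (WZ2 W) u z)
  have eVY := hY.mi_V (fun q : 𝒱 × 𝒴 => ∑ u, ∑ x, pUVX (u, q.1, x) * WY W x q.2)
    (fun v z => jV (WY W) v z)
  have eVZ := h2.mi_V (fun q : 𝒱 × 𝒵₂ => ∑ u, ∑ x, pUVX (u, q.1, x) * WZ2 W x q.2)
    (fun v z => jV (WZ2 W) v z)
  have eCY := hY.mi_cond (fun t : 𝒱 × 𝒴 × 𝒰 => ∑ x, pUVX (t.2.2, t.1, x) * WY W x t.2.1)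
    (fun v z u => aux_joint pUVX hf u v z)
  have eCZ := h1.mi_cond (fun t : 𝒱 × 𝒵₁ × 𝒰 => ∑ x, pUVX (t.2.2, t.1, x) * WZ1 W x t.2.1)
    (fun v z u => aux_joint pUVX hf u v z)
  have i1 := h2.a_nonneg
  have i3 := h2.b_nonneg
  have i4 := h1.dpi (T₂ := auxPU c (WZ2 W)) q hq (by
    intro v z₂
    unfold auxPU
    simp_rw [hdegW, Finset.mul_sum, Finset.sum_mul, mul_assoc]
    rw [Finset.sum_comm])
  have i2 := mul_le_mul_of_nonneg_right hUY hl2.le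
  rw [eUY, eUZ] at i2
  have i5 := mul_pos hpos hl2
  rw [sub_mul, eCY, eCZ] at i5
  have hcap := congrArg (fun r => r * Real.log 2) hopt
  simp only [sub_mul] at hcap
  rw [eVY, eVZ, hY.chain, h2.chain] at hcap
  refine ⟨_, _, ?_, ?_, aux_achieve W c hc pU k hY h1 h2 _ _ _ _ _ hY.chain rfl rfl rfl h2.chain
    i1 i2 i3 i4 (by linarith), ?_⟩
  · exact div_pos (by linarith) hl2
  · exact div_nonneg (by linarith) hl2.le
  · rw [← add_div, div_eq_iff hl2.ne']
    linarith
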